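/- arXiv:2406.05609 — 9 statements merged into one kernel-verified Lean document; each statement's English description precedes it below -/
import Mathlib

section
/- Let n ≥ 3 and let G be a simple graph on n vertices with λ(G) ≥ λ(K⁺_{⌈n/2⌉,⌊n/2⌋}). Then t(G) ≥ ⌊n/2⌋, and equality t(G) = ⌊n/2⌋ holds if and only if G is isomorphic to K⁺_{⌈n/2⌉,⌊n/2⌋}. -/
open Matrix

/-- The spectral radius of a finite simple graph: the largest eigenvalue of its
adjacency matrix (as a real symmetric matrix), expressed as the supremum of the
set of eigenvalues of the associated linear endomorphism. -/
noncomputable def specRad {V : Type*} [Fintype V] (G : SimpleGraph V) : ℝ :=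
  letI := Classical.decEq V
  letI := Classical.decRel G.Adj
  sSup {μ : ℝ | Module.End.HasEigenvalue (Matrix.toLin' (SimpleGraph.adjMatrix ℝ G)) μ}

/-- The number of triangles (3-cliques) of a finite simple graph. -/
noncomputable def triangleCount {V : Type*} [Fintype V] (G : SimpleGraph V) : ℕ :=
  letI := Classical.decEq V
  letI := Classical.decRel G.Adj
  (G.cliqueFinset 3).card

/-- The graph on `Fin n` obtained from the complete bipartite graph with parts
`{0, …, a-1}` and `{a, …, n-1}` by adding the extra edge `{0, 1}` inside the
first part. -/
def KbipPlus (n a : ℕ) : SimpleGraph (Fin n) :=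
  SimpleGraph.fromRel (fun u v => ((u : ℕ) < a ∧ a ≤ (v : ℕ)) ∨ ((u : ℕ) = 0 ∧ (v : ℕ) = 1))

/-- `K⁺_{⌈n/2⌉,⌊n/2⌋}`: the complete bipartite graph with parts of sizes `⌈n/2⌉`
and `⌊n/2⌋` together with one extra edge inside the part of size `⌈n/2⌉`
(added between vertices `0` and `1`). -/
def Kplus (n : ℕ) : SimpleGraph (Fin n) := KbipPlus n ((n + 1) / 2)

/-- `K^{+|}`: the graph on `Fin n` obtained from the complete bipartite graph with
parts `{0, …, a-1}` and `{a, …, n-1}` by adding the edge `e₁ = {0, 1}` inside the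
first part and deleting the cross edge `e₂ = {0, a}`, which shares the endpoint `0`
with `e₁`. -/
def KbipPlusMinus (n a : ℕ) : SimpleGraph (Fin n) :=
  SimpleGraph.fromRel (fun u v =>
    (((u : ℕ) < a ∧ a ≤ (v : ℕ)) ∧ ¬((u : ℕ) = 0 ∧ (v : ℕ) = a)) ∨
      ((u : ℕ) = 0 ∧ (v : ℕ) = 1))

namespace Matrix.IsHermitian

variable {V : Type*} [Fintype V] [DecidableEq V] {A : Matrix V V ℝ}

lemma trace_pow_eq_sum_eigenvalues_pow (hA : A.IsHermitian) (k : ℕ) :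
    (A ^ k).trace = ∑ i, hA.eigenvalues i ^ k := by
  conv_lhs => rw [hA.spectral_theorem]
  rw [← map_pow, Unitary.conjStarAlgAut_apply, trace_mul_cycle, Unitary.coe_star_mul_self, one_mul,
    diagonal_pow, trace_diagonal]
  simp

lemma dotProduct_mulVec_le_of_eigenvalues_le (hA : A.IsHermitian) {ρ : ℝ}
    (h : ∀ i, hA.eigenvalues i ≤ ρ) (x : V → ℝ) : x ⬝ᵥ (A *ᵥ x) ≤ ρ * (x ⬝ᵥ x) := by
  have hpos : (ρ • (1 : Matrix V V ℝ) - A).PosSemidef := by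
    have hdiag : ρ • (1 : Matrix V V ℝ) - A = Unitary.conjStarAlgAut ℝ _ hA.eigenvectorUnitary
        (diagonal fun i ↦ ρ - hA.eigenvalues i) := by
      have : (diagonal fun i ↦ ρ - hA.eigenvalues i) =
          ρ • (1 : Matrix V V ℝ) - diagonal (RCLike.ofReal ∘ hA.eigenvalues) := by
        rw [smul_one_eq_diagonal, diagonal_sub]
        rfl
      rw [this, map_sub, ← hA.spectral_theorem, map_smul, map_one]
    rw [hdiag, Unitary.conjStarAlgAut_apply]
    exact (Matrix.IsUnit.posSemidef_star_right_conjugate_iff Unitary.isUnit_coe).2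
      (posSemidef_diagonal_iff.2 fun i ↦ sub_nonneg.2 (h i))
  have := hpos.dotProduct_mulVec_nonneg x
  simp only [star_trivial, sub_mulVec, smul_mulVec, one_mulVec, dotProduct_sub, dotProduct_smul,
    smul_eq_mul] at this
  linarith

/-- If all eigenvalues but one have absolute value at most `c`, the third moment of the spectrum
is controlled by the second. -/
lemma le_trace_pow_three (hA : A.IsHermitian) (i : V) {c : ℝ} (hc : 0 ≤ c)
    (h : (A ^ 2).trace - hA.eigenvalues i ^ 2 ≤ c ^ 2) :
    hA.eigenvalues i ^ 3 - c * ((A ^ 2).trace - hA.eigenvalues i ^ 2) ≤ (A ^ 3).trace := by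
  simp only [hA.trace_pow_eq_sum_eigenvalues_pow] at h ⊢
  rw [← Finset.add_sum_erase _ _ (Finset.mem_univ i), add_sub_cancel_left] at h
  rw [← Finset.add_sum_erase _ (fun j ↦ hA.eigenvalues j ^ 2) (Finset.mem_univ i),
    add_sub_cancel_left, ← Finset.add_sum_erase _ (fun j ↦ hA.eigenvalues j ^ 3)
    (Finset.mem_univ i), sub_eq_add_neg, ← neg_mul, Finset.mul_sum]
  gcongr with j hj
  have hj' : hA.eigenvalues j ^ 2 ≤ c ^ 2 :=
    (Finset.single_le_sum (f := fun j ↦ hA.eigenvalues j ^ 2) (fun _ _ ↦ sq_nonneg _) hj).trans h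
  nlinarith [(abs_le.1 (abs_le_of_sq_le_sq hj' hc)).1, sq_nonneg (hA.eigenvalues j)]

end Matrix.IsHermitian

section SpectralRadius

variable {V : Type*} [Fintype V] [DecidableEq V] (G : SimpleGraph V) [DecidableRel G.Adj]

lemma specRad_eq_sSup_range :
    specRad G = sSup (Set.range (G.isHermitian_adjMatrix ℝ).eigenvalues) := by
  rw [← (G.isHermitian_adjMatrix ℝ).spectrum_real_eq_range_eigenvalues, ← Matrix.spectrum_toLin']
  unfold specRad
  congr! 1
  ext μ
  rw [← Module.End.hasEigenvalue_iff_mem_spectrum, Set.mem_ofPred_eq]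
  convert Iff.rfl <;> rfl

lemma eigenvalues_le_specRad (i : V) : (G.isHermitian_adjMatrix ℝ).eigenvalues i ≤ specRad G := by
  rw [specRad_eq_sSup_range]
  exact le_csSup (Set.finite_range _).bddAbove ⟨i, rfl⟩

lemma exists_eigenvalues_eq_specRad [Nonempty V] :
    ∃ i, (G.isHermitian_adjMatrix ℝ).eigenvalues i = specRad G := by
  rw [specRad_eq_sSup_range]
  exact (Set.range_nonempty _).csSup_mem (Set.finite_range _)

end SpectralRadius

lemma exists_spectral_parameters {n : ℕ} (hn : 3 ≤ n) :
    ∃ r c : ℝ, 1 < r ∧ 0 ≤ c ∧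
      (r ^ 2 - ((n + 1) / 2 : ℕ) * (n / 2 : ℕ)) * (r - 1) ≤ 2 * (n / 2 : ℕ) ∧
      2 * (((n + 1) / 2 : ℕ) * (n / 2 : ℕ)) - r ^ 2 ≤ c ^ 2 ∧
      6 * (n / 2 : ℕ) < r ^ 2 * (r + c) - c * (2 * (((n + 1) / 2 : ℕ) * (n / 2 : ℕ))) := by
  obtain ⟨b, rfl | rfl⟩ := n.even_or_odd'
  · rw [show (2 * b + 1) / 2 = b by omega, show 2 * b / 2 = b by omega]
    have hb : (2 : ℝ) ≤ b := by exact_mod_cast (by omega : 2 ≤ b)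
    generalize (b : ℝ) = x at hb
    obtain ⟨y, hy⟩ : ∃ y, y = x⁻¹ := ⟨_, rfl⟩
    have hxy : x * y = 1 := by rw [hy, mul_inv_cancel₀ (by positivity)]
    have hy0 : 0 < y := by rw [hy]; positivity
    have hy2 : y ≤ 1 / 2 := by nlinarith
    refine ⟨x + y, x - y, by linarith, by linarith, ?_, ?_, ?_⟩
    · have h1 : (x + y) ^ 2 - x * x = 2 + y ^ 2 := by linear_combination 2 * hxy
      have h2 : y ^ 2 * x = y := by linear_combination y * hxy
      rw [h1]
      nlinarith [mul_nonneg hy0.le hy0.le, mul_nonneg (mul_nonneg hy0.le hy0.le) hy0.le]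
    · nlinarith
    · have : (x + y) ^ 2 * (x + y + (x - y)) - (x - y) * (2 * (x * x)) = 6 * x + 2 * y := by
        linear_combination (6 * x + 2 * y) * hxy
      linarith
  · rw [show (2 * b + 1 + 1) / 2 = b + 1 by omega, show (2 * b + 1) / 2 = b by omega]
    have hb : (1 : ℝ) ≤ b := by exact_mod_cast (by omega : 1 ≤ b)
    push_cast
    obtain ⟨x, hx⟩ : ∃ x : ℝ, (b : ℝ) = x - 1 := ⟨b + 1, by ring⟩
    rw [hx] at hb ⊢
    replace hb : 2 ≤ x := by linarith
    obtain ⟨y, hy⟩ : ∃ y, y = x⁻¹ := ⟨_, rfl⟩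
    have hxy : x * y = 1 := by rw [hy, mul_inv_cancel₀ (by positivity)]
    have hy0 : 0 < y := by rw [hy]; positivity
    have hy2 : y ≤ 1 / 2 := by nlinarith
    have h1 : (x - 1 / 2 + 7 / 8 * y) ^ 2 =
        (x - 1 + 1) * (x - 1) + 2 - 7 / 8 * y + 49 / 64 * y ^ 2 := by
      linear_combination 7 / 4 * hxy
    refine ⟨x - 1 / 2 + 7 / 8 * y, x - 1 / 2 - 9 / 8 * y, by linarith, by linarith, ?_, ?_, ?_⟩
    · rw [h1]
      have h3 : 2 - 7 / 8 * y + 49 / 64 * y ^ 2 ≤ 2 := by nlinarith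
      have h4 : x - 1 / 2 + 7 / 8 * y - 1 ≤ x - 1 := by linarith
      nlinarith
    · rw [h1]
      nlinarith
    · rw [h1]
      have : ((x - 1 + 1) * (x - 1) + 2 - 7 / 8 * y + 49 / 64 * y ^ 2) *
          (x - 1 / 2 + 7 / 8 * y + (x - 1 / 2 - 9 / 8 * y)) - (x - 1 / 2 - 9 / 8 * y) *
          (2 * ((x - 1 + 1) * (x - 1))) = 6 * x - 23 / 4 + (61 / 32) * y
            - 35 / 64 * y ^ 2 - 49 / 256 * y ^ 3 := by
        linear_combination (2 * x - 15 / 4 + 49 / 32 * y) * hxy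
      rw [this]
      nlinarith [mul_pos hy0 hy0]

namespace SimpleGraph

open Finset

variable {V : Type*} (G : SimpleGraph V) (S : Finset V)

open Classical in
/-- The neighbours of `u` inside `S`. -/
noncomputable def nbrIn (u : V) : Finset V := {v ∈ S | G.Adj u v}

/-- The number of neighbours of `u` inside `S`. -/
noncomputable def degIn (u : V) : ℕ := #(G.nbrIn S u)

/-- Twice the number of edges inside `S`. -/
noncomputable def degSum : ℕ := ∑ u ∈ S, G.degIn S u

open Classical in
/-- The triangles inside `S`. -/
noncomputable def trianglesIn : Finset (Finset V) := {T ∈ S.powersetCard 3 | G.IsClique T}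

/-- On `S`, the graph is the complete bipartite graph with parts `A` and `S \ A` together with
one edge `pq` inside `A`. -/
structure IsBipartitePlusEdge (A : Finset V) (p q : V) : Prop where
  subset : A ⊆ S
  left_mem : p ∈ A
  right_mem : q ∈ A
  ne : p ≠ q
  adj_iff : ∀ u ∈ S, ∀ v ∈ S, G.Adj u v ↔
    (u ∈ A ∧ v ∉ A) ∨ (u ∉ A ∧ v ∈ A) ∨ (u = p ∧ v = q) ∨ (u = q ∧ v = p)

/-- On `S`, the graph is a balanced complete bipartite graph together with one edge inside the
larger part. -/
def IsBalancedPlusEdge : Prop :=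
  ∃ A p q, G.IsBipartitePlusEdge S A p q ∧ #A = (#S + 1) / 2

variable {G S}

@[simp]
lemma mem_nbrIn {u v : V} : v ∈ G.nbrIn S u ↔ v ∈ S ∧ G.Adj u v := by
  simp [nbrIn]

lemma nbrIn_subset (u : V) : G.nbrIn S u ⊆ S := fun _ hv ↦ (mem_nbrIn.1 hv).1

lemma degIn_lt_card {u : V} (hu : u ∈ S) : G.degIn S u < #S :=
  card_lt_card ⟨nbrIn_subset u, fun h ↦ by simpa using h hu⟩

lemma mem_trianglesIn {T : Finset V} :
    T ∈ G.trianglesIn S ↔ T ⊆ S ∧ #T = 3 ∧ G.IsClique T := by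
  simp [trianglesIn, mem_powersetCard, and_assoc]

lemma exists_degIn_le {k : ℕ} (h : G.degSum S < #S * (k + 1)) : ∃ v ∈ S, G.degIn S v ≤ k := by
  by_contra! hc
  exact h.not_ge (by simpa [degSum] using card_nsmul_le_sum S (G.degIn S) (k + 1) hc)

lemma degSum_deleteEdges_lt {x y : V} (hx : x ∈ S) (hy : y ∈ S) (hxy : G.Adj x y) :
    (G.deleteEdges {s(x, y)}).degSum S < G.degSum S := by
  have hsub : ∀ u, (G.deleteEdges {s(x, y)}).nbrIn S u ⊆ G.nbrIn S u := fun u v hv ↦ by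
    rw [mem_nbrIn] at hv ⊢
    exact ⟨hv.1, deleteEdges_le _ hv.2⟩
  refine sum_lt_sum (fun u _ ↦ card_le_card (hsub u)) ⟨x, hx, card_lt_card ⟨hsub x, fun h ↦ ?_⟩⟩
  simpa [deleteEdges_adj] using (mem_nbrIn.1 (h (mem_nbrIn.2 ⟨hy, hxy⟩))).2

lemma exists_adj_of_degSum_pos (h : 0 < G.degSum S) : ∃ x ∈ S, ∃ y ∈ S, G.Adj x y := by
  obtain ⟨x, hx, hxS⟩ := exists_ne_zero_of_sum_ne_zero h.ne'
  obtain ⟨y, hy⟩ := card_pos.1 (Nat.pos_of_ne_zero hxS)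
  exact ⟨x, hx, y, mem_nbrIn.1 hy⟩

variable [DecidableEq V]

lemma nbrIn_subset_erase (u : V) : G.nbrIn S u ⊆ S.erase u := fun v hv ↦ by
  rw [mem_nbrIn] at hv
  exact mem_erase.2 ⟨hv.2.ne', hv.1⟩

lemma insert_pair_mem_trianglesIn {a b c : V} (ha : a ∈ S) (hb : b ∈ S) (hc : c ∈ S)
    (hab : G.Adj a b) (hac : G.Adj a c) (hbc : G.Adj b c) : {a, b, c} ∈ G.trianglesIn S := by
  have h : G.IsNClique 3 {a, b, c} := is3Clique_triple_iff.2 ⟨hab, hac, hbc⟩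
  refine mem_trianglesIn.2 ⟨?_, h.card_eq, h.isClique⟩
  simp [insert_subset_iff, ha, hb, hc]

lemma exists_of_mem_trianglesIn {T : Finset V} (hT : T ∈ G.trianglesIn S) :
    ∃ a b c, a ∈ S ∧ b ∈ S ∧ c ∈ S ∧ G.Adj a b ∧ G.Adj a c ∧ G.Adj b c ∧ T = {a, b, c} := by
  obtain ⟨hTS, hT3, hTc⟩ := mem_trianglesIn.1 hT
  obtain ⟨a, b, c, hab, hac, hbc, rfl⟩ := is3Clique_iff.1 ⟨hTc, hT3⟩
  simp only [insert_subset_iff, singleton_subset_iff] at hTS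
  exact ⟨a, b, c, hTS.1, hTS.2.1, hTS.2.2, hab, hac, hbc, rfl⟩

lemma degIn_insert {v u : V} (hv : v ∉ S) (hu : u ∈ S) :
    G.degIn (insert v S) u = G.degIn S u + if u ∈ G.nbrIn S v then 1 else 0 := by
  split_ifs with h
  · rw [degIn, degIn, ← card_insert_of_notMem (a := v) (by simp [hv])]
    congr 1
    ext w
    rcases eq_or_ne w v with rfl | hw <;> simp_all [G.adj_comm]
  · rw [degIn, degIn, add_zero]
    congr 1
    ext w
    rcases eq_or_ne w v with rfl | hw <;> simp_all [G.adj_comm]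

lemma degIn_insert_self {v : V} : G.degIn (insert v S) v = G.degIn S v := by
  rw [degIn, degIn]
  congr 1
  ext w
  rcases eq_or_ne w v with rfl | hw <;> simp_all

lemma degSum_insert {v : V} (hv : v ∉ S) :
    G.degSum (insert v S) = G.degSum S + 2 * G.degIn S v := by
  rw [degSum, sum_insert hv, sum_congr rfl fun u hu ↦ degIn_insert hv hu, sum_add_distrib,
    degIn_insert_self]
  have : S ∩ G.nbrIn S v = G.nbrIn S v := inter_eq_right.2 (nbrIn_subset v)
  simp only [sum_ite_mem, this, sum_const, smul_eq_mul, mul_one, degSum, degIn]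
  ring

lemma degSum_eq_erase_add {v : V} (hv : v ∈ S) :
    G.degSum S = G.degSum (S.erase v) + 2 * G.degIn S v := by
  conv_lhs => rw [← insert_erase hv, degSum_insert (notMem_erase v S)]
  conv_rhs => rw [← insert_erase hv, degIn_insert_self]
  simp

lemma even_degSum : Even (G.degSum S) := by
  induction S using Finset.induction_on with
  | empty => simp [degSum]
  | insert v S hv ih => rw [degSum_insert hv]; exact ih.add (even_two_mul _)

lemma degIn_le_deleteEdges_add {x y : V} (hxy : x ≠ y) (u : V) :
    G.degIn S u ≤ (G.deleteEdges {s(x, y)}).degIn S u +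
      ((if u = x then 1 else 0) + if u = y then 1 else 0) := by
  have key : ∀ w, (∀ v, G.Adj u v → v = w ∨ (G.deleteEdges {s(x, y)}).Adj u v) →
      G.degIn S u ≤ (G.deleteEdges {s(x, y)}).degIn S u + 1 := fun w hw ↦ by
    refine (card_le_card (t := insert w ((G.deleteEdges {s(x, y)}).nbrIn S u)) ?_).trans
      (card_insert_le _ _)
    intro v hv
    rw [mem_nbrIn] at hv
    rcases hw v hv.2 with h | h
    · simp [h]
    · exact mem_insert_of_mem (mem_nbrIn.2 ⟨hv.1, h⟩)
  by_cases hx : u = x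
  · subst hx
    simpa [hxy] using key y fun v hv ↦ by
      rcases eq_or_ne v y with h | h <;> simp_all [deleteEdges_adj]
  by_cases hy : u = y
  · subst hy
    simpa [hx] using key x fun v hv ↦ by
      rcases eq_or_ne v x with h | h <;> simp_all [deleteEdges_adj]
  · simp only [hx, hy, if_false, add_zero]
    refine card_le_card fun v hv ↦ ?_
    simp_all [deleteEdges_adj]

lemma degSum_le_deleteEdges_add {x y : V} (hxy : x ≠ y) :
    G.degSum S ≤ (G.deleteEdges {s(x, y)}).degSum S + 2 := by
  refine (sum_le_sum fun u _ ↦ degIn_le_deleteEdges_add hxy u).trans ?_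
  simp only [sum_add_distrib, degSum, sum_ite_eq']
  split_ifs <;> omega

lemma card_trianglesIn_erase_add_le {v : V} {X : Finset (Finset V)} (hX : X ⊆ G.trianglesIn S)
    (hv : ∀ T ∈ X, v ∈ T) : #(G.trianglesIn (S.erase v)) + #X ≤ #(G.trianglesIn S) := by
  rw [← card_union_of_disjoint]
  · refine card_le_card (union_subset (fun T hT ↦ ?_) hX)
    rw [mem_trianglesIn] at hT ⊢
    exact ⟨hT.1.trans (erase_subset _ _), hT.2⟩
  · refine Finset.disjoint_left.2 fun T hT hTX ↦ ?_
    exact notMem_erase v S ((mem_trianglesIn.1 hT).1 (hv T hTX))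

lemma card_trianglesIn_erase_le (v : V) :
    #(G.trianglesIn (S.erase v)) ≤ #(G.trianglesIn S) := by
  simpa using card_trianglesIn_erase_add_le (v := v) (empty_subset (G.trianglesIn S)) (by simp)

lemma card_trianglesIn_deleteEdges_add_le {x y : V} (hxy : x ≠ y) {X : Finset (Finset V)}
    (hX : X ⊆ G.trianglesIn S) (hx : ∀ T ∈ X, x ∈ T) (hy : ∀ T ∈ X, y ∈ T) :
    #((G.deleteEdges {s(x, y)}).trianglesIn S) + #X ≤ #(G.trianglesIn S) := by
  rw [← card_union_of_disjoint]
  · refine card_le_card (union_subset (fun T hT ↦ ?_) hX)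
    rw [mem_trianglesIn] at hT ⊢
    exact ⟨hT.1, hT.2.1, hT.2.2.mono (deleteEdges_le _)⟩
  · refine Finset.disjoint_left.2 fun T hT hTX ↦ ?_
    have := (mem_trianglesIn.1 hT).2.2 (hx T hTX) (hy T hTX) hxy
    simp [deleteEdges_adj] at this

lemma card_trianglesIn_deleteEdges_le {x y : V} (hxy : x ≠ y) :
    #((G.deleteEdges {s(x, y)}).trianglesIn S) ≤ #(G.trianglesIn S) := by
  simpa using card_trianglesIn_deleteEdges_add_le hxy (empty_subset (G.trianglesIn S))
    (by simp) (by simp)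

lemma triple_left_injective {a b : V} (s : Set V) (ha : a ∉ s) (hb : b ∉ s) :
    Set.InjOn (fun z ↦ ({a, b, z} : Finset V)) s := by
  intro z hz w hw h
  have : z ∈ ({a, b, w} : Finset V) := by
    rw [← show ({a, b, z} : Finset V) = {a, b, w} from h]
    simp
  simp only [mem_insert, mem_singleton] at this
  rcases this with rfl | rfl | rfl
  exacts [(ha hz).elim, (hb hz).elim, rfl]

namespace IsBipartitePlusEdge

variable {A : Finset V} {p q : V}

lemma le_card_trianglesIn (h : G.IsBipartitePlusEdge S A p q) :
    #S - #A ≤ #(G.trianglesIn S) := by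
  rw [← card_sdiff_of_subset h.subset, ← card_image_of_injOn (f := fun z ↦ ({p, q, z} : Finset V))]
  · refine card_le_card (image_subset_iff.2 fun z hz ↦ ?_)
    rw [mem_sdiff] at hz
    have hp := h.subset h.left_mem
    have hq := h.subset h.right_mem
    have h1 := h.left_mem
    have h2 := h.right_mem
    apply insert_pair_mem_trianglesIn hp hq hz.1 <;> rw [h.adj_iff] <;> simp_all
  · exact triple_left_injective _ (by simp [h.left_mem]) (by simp [h.right_mem])

lemma card_trianglesIn_le (h : G.IsBipartitePlusEdge S A p q) :
    #(G.trianglesIn S) ≤ #S - #A := by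
  rw [← card_sdiff_of_subset h.subset]
  refine (card_le_card (t := (S \ A).image fun z ↦ ({p, q, z} : Finset V)) fun T hT ↦ ?_).trans
    card_image_le
  obtain ⟨a, b, c, ha, hb, hc, hab, hac, hbc, rfl⟩ := exists_of_mem_trianglesIn hT
  have h1 := h.left_mem
  have h2 := h.right_mem
  have h3 := h.ne
  rw [h.adj_iff _ ha _ hb] at hab
  rw [h.adj_iff _ ha _ hc] at hac
  rw [h.adj_iff _ hb _ hc] at hbc
  simp only [mem_image, mem_sdiff]
  have hext : ∀ z, ({p, q, z} : Finset V) = {a, b, c} ↔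
    ∀ w, (w = p ∨ w = q ∨ w = z) ↔ (w = a ∨ w = b ∨ w = c) := fun z ↦ by simp [Finset.ext_iff]
  simp only [hext]
  by_cases hA : a ∈ A
  · by_cases hB : b ∈ A
    · exact ⟨c, by grind⟩
    · exact ⟨b, by grind⟩
  · exact ⟨a, by grind⟩

end IsBipartitePlusEdge

lemma IsBalancedPlusEdge.le_card_trianglesIn (h : G.IsBalancedPlusEdge S) :
    #S / 2 ≤ #(G.trianglesIn S) := by
  obtain ⟨A, p, q, h, hA⟩ := h
  have := h.le_card_trianglesIn
  omega

lemma IsBalancedPlusEdge.card_trianglesIn_le (h : G.IsBalancedPlusEdge S) :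
    #(G.trianglesIn S) ≤ #S / 2 := by
  obtain ⟨A, p, q, h, hA⟩ := h
  have := h.card_trianglesIn_le
  omega

variable (V) in
/-- The Erdős–Rademacher theorem with its equality case, for induced subgraphs on `n` vertices
of graphs on `V`. -/
def ErdosRademacherAt (n : ℕ) : Prop :=
  ∀ (G : SimpleGraph V) (S : Finset V), #S = n → 2 * ((n + 1) / 2 * (n / 2) + 1) ≤ G.degSum S →
    #(G.trianglesIn S) ≤ n / 2 → G.IsBalancedPlusEdge S

/-- A graph with an edge to spare has more triangles than the extremal graph, provided that
its edge-deleted subgraphs satisfy the Erdős–Rademacher theorem. -/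
lemma half_card_lt_card_trianglesIn_of_deleteEdges {k : ℕ} (hS : 2 ≤ #S)
    (hE : 2 * k + 2 ≤ G.degSum S)
    (ih : ∀ x ∈ S, ∀ y ∈ S, G.Adj x y → 2 * k ≤ (G.deleteEdges {s(x, y)}).degSum S →
      #((G.deleteEdges {s(x, y)}).trianglesIn S) ≤ #S / 2 →
      (G.deleteEdges {s(x, y)}).IsBalancedPlusEdge S) :
    #S / 2 < #(G.trianglesIn S) := by
  by_contra! ht
  have key : ∀ x ∈ S, ∀ y ∈ S, G.Adj x y →
      #S / 2 ≤ #((G.deleteEdges {s(x, y)}).trianglesIn S) := fun x hx y hy hxy ↦ by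
    have h1 := degSum_le_deleteEdges_add (G := G) (S := S) hxy.ne
    have h2 := card_trianglesIn_deleteEdges_le (G := G) (S := S) hxy.ne
    exact (ih x hx y hy hxy (by omega) (by omega)).le_card_trianglesIn
  obtain ⟨x, hx, y, hy, hxy⟩ := exists_adj_of_degSum_pos (show 0 < G.degSum S by omega)
  have h2 := card_trianglesIn_deleteEdges_le (G := G) (S := S) hxy.ne
  have h3 := key x hx y hy hxy
  obtain ⟨T, hT⟩ := card_pos.1 (show 0 < #(G.trianglesIn S) by omega)
  obtain ⟨a, b, c, ha, hb, hc, hab, hac, hbc, rfl⟩ := exists_of_mem_trianglesIn hT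
  have h4 := card_trianglesIn_deleteEdges_add_le hab.ne (singleton_subset_iff.2 hT)
    (by simp) (by simp)
  have h5 := key a ha b hb hab
  rw [card_singleton] at h4
  omega

lemma erdosRademacherAt_of_eq {n : ℕ} (hn : 2 ≤ n)
    (h : ∀ (G : SimpleGraph V) (S : Finset V), #S = n →
      G.degSum S = 2 * ((n + 1) / 2 * (n / 2) + 1) → #(G.trianglesIn S) ≤ n / 2 →
      G.IsBalancedPlusEdge S) : ErdosRademacherAt V n := by
  intro G S hS hE ht
  induction hm : G.degSum S using Nat.strong_induction_on generalizing G with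
  | _ m ih =>
    rcases hE.eq_or_lt with heq | hlt
    · exact h G S hS heq.symm ht
    · obtain ⟨r, hr⟩ := even_degSum (G := G) (S := S)
      refine absurd ht (not_le.2 ?_)
      rw [← hS]
      refine half_card_lt_card_trianglesIn_of_deleteEdges
        (k := (n + 1) / 2 * (n / 2) + 1) (by omega) (by omega) fun x hx y hy hxy hE' ht' ↦ ?_
      exact ih _ (hm ▸ degSum_deleteEdges_lt hx hy hxy) _ hE' (hS ▸ ht') rfl

namespace ErdosRademacherAt

variable {n : ℕ}

lemma half_card_lt (h : ErdosRademacherAt V n) (hn : 2 ≤ n) (hS : #S = n)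
    (hE : 2 * ((n + 1) / 2 * (n / 2) + 2) ≤ G.degSum S) : n / 2 < #(G.trianglesIn S) := by
  subst hS
  exact half_card_lt_card_trianglesIn_of_deleteEdges (k := (#S + 1) / 2 * (#S / 2) + 1) hn
    (by omega) fun x _ y _ _ hE' ht' ↦ h _ S rfl hE' ht'

lemma half_card_add_two_le (h : ErdosRademacherAt V n) (hn : 4 ≤ n) (hS : #S = n)
    (hE : 2 * ((n + 1) / 2 * (n / 2) + 2) ≤ G.degSum S) : n / 2 + 2 ≤ #(G.trianglesIn S) := by
  have h0 := h.half_card_lt (by omega) hS hE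
  by_contra! ht
  obtain ⟨T, hT⟩ := card_pos.1 (show 0 < #(G.trianglesIn S) by omega)
  obtain ⟨x, y, c, hx, hy, hc, hxy, hxc, hyc, rfl⟩ := exists_of_mem_trianglesIn hT
  have h4 := card_trianglesIn_deleteEdges_add_le hxy.ne (singleton_subset_iff.2 hT)
    (by simp) (by simp)
  have h5 := degSum_le_deleteEdges_add (G := G) (S := S) hxy.ne
  rw [card_singleton] at h4
  have hbal := h (G.deleteEdges {s(x, y)}) S hS (by omega) (by omega)
  have h6 := hbal.le_card_trianglesIn
  obtain ⟨A, p, q, hA, hAcard⟩ := hbal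
  have hle : ∀ u v, (G.deleteEdges {s(x, y)}).Adj u v → G.Adj u v := fun u v huv ↦
    deleteEdges_le _ huv
  have hnot : ¬ (G.deleteEdges {s(x, y)}).Adj x y := by simp [deleteEdges_adj]
  have hside : x ∈ A ↔ y ∈ A := by
    rw [hA.adj_iff x hx y hy] at hnot
    tauto
  obtain ⟨C, hCS, hC2, hCx⟩ : ∃ C ⊆ S, 2 ≤ #C ∧ ∀ z ∈ C, (z ∈ A ↔ x ∉ A) := by
    have := card_sdiff_of_subset hA.subset
    by_cases hxA : x ∈ A
    · exact ⟨S \ A, sdiff_subset, by omega, by simp_all⟩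
    · exact ⟨A, hA.subset, by omega, by simp_all⟩
  have hxC : x ∉ C := fun hC ↦ by have := hCx x hC; tauto
  have hyC : y ∉ C := fun hC ↦ by have := hCx y hC; tauto
  have h7 := card_trianglesIn_deleteEdges_add_le hxy.ne (G := G) (S := S)
    (X := C.image fun z ↦ {x, y, z}) (image_subset_iff.2 fun z hz ↦
      insert_pair_mem_trianglesIn hx hy (hCS hz) hxy
        (hle _ _ ((hA.adj_iff x hx z (hCS hz)).2 (by have := hCx z hz; tauto)))
        (hle _ _ ((hA.adj_iff y hy z (hCS hz)).2 (by have := hCx z hz; tauto))))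
    (by simp) (by simp)
  rw [card_image_of_injOn (triple_left_injective _ (by simpa) (by simpa))] at h7
  omega

end ErdosRademacherAt

lemma isBalancedPlusEdge_of_pairwise_adj (hS : #S = 3)
    (h : ∀ u ∈ S, ∀ v ∈ S, u ≠ v → G.Adj u v) : G.IsBalancedPlusEdge S := by
  obtain ⟨x, y, z, hxy, hxz, hyz, rfl⟩ := card_eq_three.1 hS
  refine ⟨{x, y}, x, y, ⟨by grind, by simp, by simp, hxy, fun u hu v hv ↦ ?_⟩, ?_⟩
  · have h1 := h u hu v hv
    have h2 : u = v → ¬ G.Adj u v := by rintro rfl; exact G.irrefl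
    simp only [mem_insert, mem_singleton] at hu hv ⊢
    rcases hu with rfl | rfl | rfl <;> rcases hv with rfl | rfl | rfl <;> simp_all <;> tauto
  · rw [hS, card_pair hxy]

lemma erdosRademacherAt_three : ErdosRademacherAt V 3 := by
  intro G S hS hE _
  refine isBalancedPlusEdge_of_pairwise_adj hS fun u hu v hv huv ↦ ?_
  have hle : ∀ w ∈ S, G.degIn S w ≤ 2 := fun w hw ↦ by
    have := degIn_lt_card (G := G) hw
    omega
  have hu2 : 2 ≤ G.degIn S u := by
    by_contra! hlt
    have := sum_lt_sum hle ⟨u, hu, hlt⟩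
    simp only [sum_const, hS, smul_eq_mul] at this
    rw [degSum] at hE
    omega
  have heq := eq_of_subset_of_card_le (nbrIn_subset_erase u)
    (by rw [card_erase_of_mem hu, hS]; exact hu2)
  exact (mem_nbrIn.1 (heq ▸ mem_erase.2 ⟨huv.symm, hv⟩ : v ∈ G.nbrIn S u)).2

/-- Adding a vertex `v` whose neighbourhood is the larger part `A`. -/
lemma IsBipartitePlusEdge.of_erase_of_nbrIn_eq_left {A : Finset V} {p q v : V} (hv : v ∈ S)
    (h : G.IsBipartitePlusEdge (S.erase v) A p q) (hN : G.nbrIn S v = A) :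
    G.IsBipartitePlusEdge S A p q := by
  have hadj : ∀ u ∈ S, G.Adj v u ↔ u ∈ A := fun u hu ↦ by rw [← hN, mem_nbrIn]; simp [hu]
  have hvA : v ∉ A := fun hvA ↦ notMem_erase v S (h.subset hvA)
  have h1 := h.left_mem
  have h2 := h.right_mem
  refine ⟨h.subset.trans (erase_subset _ _), h1, h2, h.ne, fun u hu w hw ↦ ?_⟩
  by_cases huv : u = v
  · subst huv
    rw [hadj w hw]
    grind
  by_cases hwv : w = v
  · subst hwv
    rw [G.adj_comm, hadj u hu]
    grind
  exact h.adj_iff u (mem_erase.2 ⟨huv, hu⟩) w (mem_erase.2 ⟨hwv, hw⟩)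

/-- Adding a vertex `v` whose neighbourhood is the part complementary to `A`. -/
lemma IsBipartitePlusEdge.of_erase_of_nbrIn_eq_right {A : Finset V} {p q v : V} (hv : v ∈ S)
    (h : G.IsBipartitePlusEdge (S.erase v) A p q) (hN : G.nbrIn S v = S.erase v \ A) :
    G.IsBipartitePlusEdge S (insert v A) p q := by
  have hadj : ∀ u ∈ S, G.Adj v u ↔ u ≠ v ∧ u ∉ A := fun u hu ↦ by
    have : u ∈ G.nbrIn S v ↔ u ∈ S.erase v \ A := by rw [hN]
    simpa [hu] using this
  have hvA : v ∉ A := fun hvA ↦ notMem_erase v S (h.subset hvA)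
  have h1 := h.left_mem
  have h2 := h.right_mem
  refine ⟨insert_subset hv (h.subset.trans (erase_subset _ _)), mem_insert_of_mem h1,
    mem_insert_of_mem h2, h.ne, fun u hu w hw ↦ ?_⟩
  by_cases huv : u = v
  · subst huv
    rw [hadj w hw]
    grind
  by_cases hwv : w = v
  · subst hwv
    rw [G.adj_comm, hadj u hu]
    grind
  rw [h.adj_iff u (mem_erase.2 ⟨huv, hu⟩) w (mem_erase.2 ⟨hwv, hw⟩)]
  grind

lemma ErdosRademacherAt.odd_succ {b : ℕ} (hb : 2 ≤ b) (ih : ErdosRademacherAt V (2 * b)) :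
    ErdosRademacherAt V (2 * b + 1) := by
  refine erdosRademacherAt_of_eq (by omega) fun G S hS hE ht ↦ ?_
  have e1 : (2 * b + 1 + 1) / 2 = b + 1 := by omega
  have e2 : (2 * b + 1) / 2 = b := by omega
  have e3 : 2 * b / 2 = b := by omega
  rw [e1, e2] at hE
  rw [e2] at ht
  obtain ⟨v, hv, hvb⟩ : ∃ v ∈ S, G.degIn S v ≤ b := exists_degIn_le (by rw [hS, hE]; nlinarith)
  have hdeg := degSum_eq_erase_add (G := G) hv
  have hcard : #(S.erase v) = 2 * b := by rw [card_erase_of_mem hv, hS]; rfl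
  have ht' := card_trianglesIn_erase_le (G := G) (S := S) v
  have hvb' : G.degIn S v = b := by
    by_contra hne
    have hlt : G.degIn S v + 1 ≤ b := by omega
    have := ih.half_card_lt (G := G) (by omega) hcard (by rw [e2, e3]; nlinarith)
    omega
  have hbal := ih G (S.erase v) hcard (by rw [e2, e3]; nlinarith) (by omega)
  have ht'' := hbal.le_card_trianglesIn
  obtain ⟨A, p, q, hA, hAcard⟩ := hbal
  have hnot : ∀ x ∈ G.nbrIn S v, ∀ y ∈ G.nbrIn S v, ¬ G.Adj x y := fun x hx y hy hxy ↦ by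
    rw [mem_nbrIn] at hx hy
    have := card_trianglesIn_erase_add_le (v := v) (singleton_subset_iff.2
      (insert_pair_mem_trianglesIn hv hx.1 hy.1 hx.2 hy.2 hxy)) (by simp)
    rw [card_singleton] at this
    omega
  have hsub := nbrIn_subset_erase (G := G) (S := S) v
  have hNA : ¬ G.nbrIn S v ⊆ A := fun hle ↦ by
    have heq := eq_of_subset_of_card_le hle (by rw [hAcard, hcard]; unfold degIn at hvb'; omega)
    exact hnot p (heq ▸ hA.left_mem) q (heq ▸ hA.right_mem)
      ((hA.adj_iff p (hA.subset hA.left_mem) q (hA.subset hA.right_mem)).2 (by simp))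
  obtain ⟨z, hz, hzA⟩ := not_subset.1 hNA
  have hN : G.nbrIn S v = S.erase v \ A := by
    refine eq_of_subset_of_card_le (fun y hy ↦ mem_sdiff.2 ⟨hsub hy, fun hyA ↦ ?_⟩) ?_
    · exact hnot y hy z hz ((hA.adj_iff y (hsub hy) z (hsub hz)).2 (by simp [hyA, hzA]))
    · rw [card_sdiff_of_subset hA.subset]
      unfold degIn at hvb'
      omega
  refine ⟨_, p, q, hA.of_erase_of_nbrIn_eq_right hv hN, ?_⟩
  rw [card_insert_of_notMem fun hvA ↦ notMem_erase v S (hA.subset hvA)]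
  omega

lemma ErdosRademacherAt.even_succ {b : ℕ} (hb : 1 ≤ b) (ih : ErdosRademacherAt V (2 * b + 1)) :
    ErdosRademacherAt V (2 * b + 2) := by
  refine erdosRademacherAt_of_eq (by omega) fun G S hS hE ht ↦ ?_
  have e1 : (2 * b + 1 + 1) / 2 = b + 1 := by omega
  have e2 : (2 * b + 1) / 2 = b := by omega
  have e3 : (2 * b + 2 + 1) / 2 = b + 1 := by omega
  have e4 : (2 * b + 2) / 2 = b + 1 := by omega
  rw [e3, e4] at hE
  rw [e4] at ht
  have hcard : ∀ v ∈ S, #(S.erase v) = 2 * b + 1 := fun v hv ↦ by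
    rw [card_erase_of_mem hv, hS]; rfl
  have hsub := nbrIn_subset_erase (G := G) (S := S)
  have hmin : ∀ v ∈ S, b + 1 ≤ G.degIn S v := fun v hv ↦ by
    by_contra! hlt
    have hdeg := degSum_eq_erase_add (G := G) hv
    have hE' : 2 * ((b + 1) * b + 2) ≤ G.degSum (S.erase v) := by nlinarith
    rcases hb.eq_or_lt with rfl | hb2
    · have : G.degSum (S.erase v) ≤ #(S.erase v) • 2 := sum_le_card_nsmul _ _ _ fun w hw ↦ by
        have := degIn_lt_card (G := G) hw
        have := hcard v hv
        omega
      rw [hcard v hv, smul_eq_mul] at this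
      omega
    · have := ih.half_card_add_two_le (G := G) (by omega) (hcard v hv) (by rwa [e1, e2])
      have := card_trianglesIn_erase_le (G := G) (S := S) v
      omega
  have hstep : ∀ v ∈ S, G.degIn S v = b + 1 → #(G.trianglesIn (S.erase v)) ≤ b →
      G.IsBalancedPlusEdge (S.erase v) := fun v hv hvb ht' ↦ by
    have hdeg := degSum_eq_erase_add (G := G) hv
    exact ih G _ (hcard v hv) (by rw [e1, e2]; nlinarith) (by omega)
  obtain ⟨T, hT⟩ : (G.trianglesIn S).Nonempty := by
    obtain ⟨v, hv, hvb⟩ : ∃ v ∈ S, G.degIn S v ≤ b + 1 :=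
      exists_degIn_le (by rw [hS, hE]; nlinarith)
    have h1 := card_trianglesIn_erase_le (G := G) (S := S) v
    rw [← card_pos]
    by_contra! h0
    have := (hstep v hv (hvb.antisymm (hmin v hv)) (by omega)).le_card_trianglesIn
    rw [hcard v hv] at this
    omega
  obtain ⟨hTS, hT3, -⟩ := mem_trianglesIn.1 hT
  obtain ⟨v, hvT, hvb⟩ : ∃ v ∈ T, G.degIn S v = b + 1 := by
    by_contra! hne
    have h1 : #T • (b + 2) ≤ ∑ v ∈ T, G.degIn S v := card_nsmul_le_sum _ _ _ fun w hw ↦ by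
      have := hmin w (hTS hw)
      have := hne w hw
      omega
    have h2 : #(S \ T) • (b + 1) ≤ ∑ v ∈ S \ T, G.degIn S v :=
      card_nsmul_le_sum _ _ _ fun w hw ↦ hmin w (mem_sdiff.1 hw).1
    have h3 : _ = G.degSum S := sum_sdiff hTS
    have h4 := card_sdiff_of_subset hTS
    have h5 := card_le_card hTS
    simp only [smul_eq_mul] at h1 h2
    have h6 : #(S \ T) = 2 * b - 1 := by omega
    obtain ⟨d, rfl⟩ : ∃ d, b = d + 1 := ⟨b - 1, by omega⟩
    rw [h6, show 2 * (d + 1) - 1 = 2 * d + 1 by omega] at h2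
    rw [hT3] at h1
    nlinarith
  have hv := hTS hvT
  have htwo : ∀ T₁ ∈ G.trianglesIn S, ∀ T₂ ∈ G.trianglesIn S, v ∈ T₁ → v ∈ T₂ →
      #(G.trianglesIn (S.erase v)) = b → T₁ = T₂ := fun T₁ h₁ T₂ h₂ hv₁ hv₂ hb' ↦ by
    by_contra hne
    have := card_trianglesIn_erase_add_le (G := G) (S := S) (v := v) (X := {T₁, T₂})
      (by simp [insert_subset_iff, h₁, h₂]) (by simp [hv₁, hv₂])
    rw [card_pair hne] at this
    omega
  have hone := card_trianglesIn_erase_add_le (v := v) (singleton_subset_iff.2 hT) (by simpa)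
  rw [card_singleton] at hone
  have hbal := hstep v hv hvb (by omega)
  have hge := hbal.le_card_trianglesIn
  have hcardv := hcard v hv
  obtain ⟨A, p, q, hA, hAcard⟩ := hbal
  suffices ∃ A' p' q', G.IsBipartitePlusEdge (S.erase v) A' p' q' ∧ G.nbrIn S v = A' by
    obtain ⟨A', p', q', hA', hN⟩ := this
    refine ⟨A', p', q', hA'.of_erase_of_nbrIn_eq_left hv hN, ?_⟩
    rw [← hN, hS]
    exact hvb.trans (by omega)
  rcases hb.eq_or_lt with rfl | hb2
  · have hpair : ∀ x ∈ S.erase v, ∀ y ∈ S.erase v, x ≠ y → G.Adj x y := by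
      intro x hx y hy hxy
      rw [hA.adj_iff x hx y hy]
      obtain ⟨p', q', hpq, rfl⟩ := card_eq_two.1 (show #A = 2 by omega)
      obtain ⟨r, hr⟩ := card_eq_one.1 (show #(S.erase v \ {p', q'}) = 1 by
        rw [card_sdiff_of_subset hA.subset]; omega)
      have hr' : ∀ w ∈ S.erase v, w = r ∨ w = p' ∨ w = q' := fun w hw ↦ by
        by_cases hw' : w ∈ ({p', q'} : Finset V)
        · simp only [mem_insert, mem_singleton] at hw'; tauto
        · exact Or.inl (mem_singleton.1 (hr ▸ mem_sdiff.2 ⟨hw, hw'⟩))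
      have h1 := hA.left_mem
      have h2 := hA.right_mem
      have h3 := hA.ne
      have h4 : r ∉ ({p', q'} : Finset V) := (mem_sdiff.1 (hr ▸ mem_singleton_self r :
        r ∈ S.erase v \ {p', q'})).2
      have := hr' x hx
      have := hr' y hy
      simp only [mem_insert, mem_singleton] at *
      grind
    obtain ⟨p', q', hpq, hN⟩ := card_eq_two.1 (show #(G.nbrIn S v) = 2 from hvb)
    have hsubv := hsub v
    rw [hN] at hsubv ⊢
    obtain ⟨r, hr⟩ := card_eq_one.1 (show #(S.erase v \ {p', q'}) = 1 by
      rw [card_sdiff_of_subset hsubv, card_pair hpq]; omega)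
    refine ⟨{p', q'}, p', q', ⟨hsubv, by simp, by simp, hpq, fun x hx y hy ↦ ?_⟩, rfl⟩
    have hr' : ∀ w ∈ S.erase v, w ∈ ({p', q'} : Finset V) ∨ w = r := fun w hw ↦ by
      by_cases hw' : w ∈ ({p', q'} : Finset V)
      · exact Or.inl hw'
      · exact Or.inr (mem_singleton.1 (hr ▸ mem_sdiff.2 ⟨hw, hw'⟩))
    have h4 : r ∉ ({p', q'} : Finset V) := (mem_sdiff.1 (hr ▸ mem_singleton_self r :
      r ∈ S.erase v \ {p', q'})).2
    have h5 : G.Adj x y ↔ x ≠ y := ⟨G.ne_of_adj, hpair x hx y hy⟩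
    have := hr' x hx
    have := hr' y hy
    rw [h5]
    simp only [mem_insert, mem_singleton] at *
    grind
  · refine ⟨A, p, q, hA, by_contra fun hNA ↦ ?_⟩
    have hNcard : #(G.nbrIn S v) = b + 1 := hvb
    have hnotA : ¬ G.nbrIn S v ⊆ A := fun hle ↦ hNA (eq_of_subset_of_card_le hle (by omega))
    obtain ⟨z, hz, hzA⟩ := not_subset.1 hnotA
    have hnotB : ¬ G.nbrIn S v ⊆ S.erase v \ A := fun hle ↦ by
      have := card_le_card hle
      rw [card_sdiff_of_subset hA.subset] at this
      omega
    obtain ⟨y, hy, hyB⟩ := not_subset.1 hnotB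
    have hyA : y ∈ A := by
      have := hsub v hy
      simp only [mem_sdiff] at hyB
      tauto
    obtain ⟨w, hw, hwyz⟩ := exists_mem_notMem_of_card_lt_card (s := {y, z}) (t := G.nbrIn S v)
      (card_le_two.trans_lt (by omega))
    simp only [mem_insert, mem_singleton, not_or] at hwyz
    have hcross : ∀ c ∈ G.nbrIn S v, ∀ d ∈ G.nbrIn S v, c ∈ A → d ∉ A →
        {v, c, d} ∈ G.trianglesIn S := fun c hc d hd hcA hdA ↦ by
      have hadj := (hA.adj_iff c (hsub v hc) d (hsub v hd)).2 (by simp [hcA, hdA])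
      rw [mem_nbrIn] at hc hd
      exact insert_pair_mem_trianglesIn hv hc.1 hd.1 hc.2 hd.2 hadj
    have hwv : w ≠ v := (mem_erase.1 (hsub v hw)).1
    have hwT : w ∈ ({v, y, z} : Finset V) := by
      by_cases hwA : w ∈ A
      · rw [htwo _ (hcross y hy z hz hyA hzA) _ (hcross w hw z hz hwA hzA) (by simp) (by simp)
          (by omega)]
        simp
      · rw [htwo _ (hcross y hy z hz hyA hzA) _ (hcross y hy w hw hyA hwA) (by simp) (by simp)
          (by omega)]
        simp
    simp only [mem_insert, mem_singleton] at hwT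
    tauto

/-- The Erdős–Rademacher theorem, with the equality case. -/
theorem erdosRademacherAt {n : ℕ} (hn : 3 ≤ n) : ErdosRademacherAt V n := by
  induction n, hn using Nat.le_induction with
  | base => exact erdosRademacherAt_three
  | succ n hn ih =>
    obtain ⟨b, rfl | rfl⟩ := n.even_or_odd'
    · exact ih.odd_succ (by omega)
    · exact ih.even_succ (by omega)

end SimpleGraph

namespace SimpleGraph

open Finset

section Trace

variable {V : Type*} [Fintype V] (G : SimpleGraph V)

lemma triangleCount_eq_card_trianglesIn : triangleCount G = #(G.trianglesIn univ) := by
  unfold triangleCount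
  congr 1
  ext T
  simp only [mem_trianglesIn, mem_cliqueFinset_iff, isNClique_iff, subset_univ, true_and, and_comm]

variable [DecidableRel G.Adj]

lemma nbrIn_univ (u : V) : G.nbrIn univ u = G.neighborFinset u := by
  ext v
  simp

variable [DecidableEq V]

lemma trace_adjMatrix_sq : ((G.adjMatrix ℝ) ^ 2).trace = G.degSum univ := by
  simp only [Matrix.trace, sq, Matrix.diag_apply, adjMatrix_mul_self_apply_self, degSum, degIn,
    nbrIn_univ, card_neighborFinset_eq_degree, Nat.cast_sum]

lemma trace_adjMatrix_pow_three_le :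
    ((G.adjMatrix ℝ) ^ 3).trace ≤ 6 * #(G.trianglesIn univ) := by
  let P : Finset (V × V × V) := {x | G.Adj x.1 x.2.1 ∧ G.Adj x.2.1 x.2.2 ∧ G.Adj x.2.2 x.1}
  have htrace : ((G.adjMatrix ℝ) ^ 3).trace = #P := by
    rw [card_filter, Fintype.sum_prod_type]
    push_cast
    simp only [Matrix.trace, pow_succ, pow_zero, one_mul, Matrix.diag_apply, Matrix.mul_apply,
      sum_mul, adjMatrix_apply, Fintype.sum_prod_type]
    refine sum_congr rfl fun u _ ↦ ?_
    rw [sum_comm]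
    refine sum_congr rfl fun v _ ↦ sum_congr rfl fun w _ ↦ ?_
    split_ifs <;> simp_all
  have hcard : #P ≤ 6 * #(G.trianglesIn univ) := by
    refine card_le_mul_card_image_of_maps_to (f := fun x ↦ {x.1, x.2.1, x.2.2}) ?_ 6 ?_
    · rintro ⟨u, v, w⟩ hx
      simp only [P, mem_filter_univ] at hx
      exact insert_pair_mem_trianglesIn (mem_univ _) (mem_univ _) (mem_univ _) hx.1 hx.2.2.symm
        hx.2.1
    · intro T hT
      obtain ⟨a, b, c, -, -, -, hab, hac, hbc, rfl⟩ := exists_of_mem_trianglesIn hT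
      refine (card_le_card (t := {(a, b, c), (a, c, b), (b, a, c), (b, c, a), (c, a, b),
        (c, b, a)}) ?_).trans card_le_six
      rintro ⟨u, v, w⟩ hx
      simp only [P, mem_filter, mem_univ, true_and] at hx
      obtain ⟨⟨huv, hvw, hwu⟩, hT⟩ := hx
      have hu : u ∈ ({a, b, c} : Finset V) := hT ▸ by simp
      have hv : v ∈ ({a, b, c} : Finset V) := hT ▸ by simp
      have hw : w ∈ ({a, b, c} : Finset V) := hT ▸ by simp
      have := huv.ne
      have := hvw.ne
      have := hwu.ne
      simp only [mem_insert, mem_singleton, Prod.mk.injEq] at *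
      grind
  rw [htrace]
  exact_mod_cast hcard

end Trace

namespace IsBipartitePlusEdge

variable {V : Type*} [Fintype V] [DecidableEq V] {G : SimpleGraph V} {A : Finset V} {p q : V}

lemma le_specRad (h : G.IsBipartitePlusEdge univ A p q) (hA : #Aᶜ ≠ 0) {r : ℝ} (hr : 1 < r)
    (hle : (r ^ 2 - #A * #Aᶜ) * (r - 1) ≤ 2 * #Aᶜ) : r ≤ specRad G := by
  classical
  have hb : (0 : ℝ) < #Aᶜ := by positivity
  let y : ℝ := r * (r - 1) / #Aᶜ
  have hy : 0 < y := by have := sub_pos.2 hr; positivity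
  have hby : #Aᶜ * y = r * (r - 1) := mul_div_cancel₀ _ hb.ne'
  let x : V → ℝ := fun v ↦ if v ∈ A then r - 1 + (if v = p then 1 else 0) + if v = q then 1 else 0
    else y
  have hx0 : ∀ v, 0 < x v := fun v ↦ by
    simp only [x]
    split_ifs <;> linarith
  have hxA : ∀ v, v ∉ A → x v = y := fun v hv ↦ if_neg hv
  have hxp : x p = r := by simp [x, h.left_mem, h.ne]
  have hxq : x q = r := by simp [x, h.right_mem, h.ne.symm]
  have hsumA : ∑ v ∈ A, x v = #A * (r - 1) + 2 := by
    rw [sum_congr rfl fun v hv ↦ if_pos hv, sum_add_distrib, sum_add_distrib, sum_const]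
    simp [h.left_mem, h.right_mem]
    ring
  have hsumB : ∑ v ∈ Aᶜ, x v = r * (r - 1) := by
    rw [sum_congr rfl fun v hv ↦ hxA v (mem_compl.1 hv), sum_const, nsmul_eq_mul, hby]
  have hmono : ∀ u, ∀ T : Finset V, (∀ v ∈ T, G.Adj u v) →
      ∑ v ∈ T, x v ≤ (G.adjMatrix ℝ *ᵥ x) u := fun u T hT ↦ by
    rw [adjMatrix_mulVec_apply]
    exact sum_le_sum_of_subset_of_nonneg (fun v hv ↦ by simpa using hT v hv)
      fun v _ _ ↦ (hx0 v).le
  have hadj : ∀ u v, G.Adj u v ↔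
      (u ∈ A ∧ v ∉ A) ∨ (u ∉ A ∧ v ∈ A) ∨ (u = p ∧ v = q) ∨ (u = q ∧ v = p) :=
    fun u v ↦ h.adj_iff u (mem_univ _) v (mem_univ _)
  have hend : ∀ u w, w ∈ A → x w = r → x u = r → u ∈ A → G.Adj u w →
      r * x u ≤ (G.adjMatrix ℝ *ᵥ x) u := fun u w hw hxw hxu hu huw ↦ by
    refine le_trans (le_of_eq ?_) (hmono u (insert w Aᶜ) ?_)
    · rw [sum_insert (by simpa), hsumB, hxw, hxu]
      ring
    · simp only [mem_insert, mem_compl]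
      rintro v (rfl | hv)
      · exact huw
      · exact (hadj u v).2 (Or.inl ⟨hu, hv⟩)
  have hcomp : ∀ u, r * x u ≤ (G.adjMatrix ℝ *ᵥ x) u := fun u ↦ by
    by_cases hu : u ∈ A
    · by_cases hup : u = p
      · subst hup
        exact hend u q h.right_mem hxq hxp hu ((hadj _ _).2 (by simp))
      by_cases huq : u = q
      · subst huq
        exact hend u p h.left_mem hxp hxq hu ((hadj _ _).2 (by simp))
      · refine le_trans (le_of_eq ?_) (hmono u Aᶜ fun v hv ↦ (hadj u v).2
          (Or.inl ⟨hu, mem_compl.1 hv⟩))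
        simp [hsumB, x, hu, hup, huq]
    · refine le_trans ?_ (hmono u A fun v hv ↦ (hadj u v).2 (Or.inr (Or.inl ⟨hu, hv⟩)))
      rw [hsumA, hxA u hu, ← mul_div_assoc, div_le_iff₀ hb]
      nlinarith
  have hxx : 0 < x ⬝ᵥ x := sum_pos (fun v _ ↦ mul_pos (hx0 v) (hx0 v)) ⟨p, mem_univ p⟩
  refine le_of_mul_le_mul_right (le_trans ?_
    ((G.isHermitian_adjMatrix ℝ).dotProduct_mulVec_le_of_eigenvalues_le
      (eigenvalues_le_specRad G) x)) hxx
  rw [dotProduct, mul_sum]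
  refine sum_le_sum fun v _ ↦ ?_
  rw [mul_left_comm]
  exact mul_le_mul_of_nonneg_left (hcomp v) (hx0 v).le

end IsBipartitePlusEdge

namespace IsBalancedPlusEdge

variable {V W : Type*} [Fintype V] [Fintype W] {G : SimpleGraph V} {H : SimpleGraph W}

lemma nonempty_iso (hG : G.IsBalancedPlusEdge univ) (hH : H.IsBalancedPlusEdge univ)
    (hcard : Fintype.card V = Fintype.card W) : Nonempty (G ≃g H) := by
  classical
  obtain ⟨A, p, q, hA, hAcard⟩ := hG
  obtain ⟨B, p', q', hB, hBcard⟩ := hH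
  rw [card_univ] at hAcard hBcard
  obtain ⟨e₀, he₀⟩ : ∃ e : V ≃ W, ∀ v, v ∈ A ↔ e v ∈ B := by
    have e₁ : A ≃ B := A.equivOfCardEq (by omega)
    have e₂ : {v // v ∉ A} ≃ {w // w ∉ B} := Fintype.equivOfCardEq (by
      rw [Fintype.card_subtype_compl, Fintype.card_subtype_compl, Fintype.card_coe,
        Fintype.card_coe]
      omega)
    refine ⟨(Equiv.sumCompl (· ∈ A)).symm.trans ((e₁.sumCongr e₂).trans
      (Equiv.sumCompl (· ∈ B))), fun v ↦ ?_⟩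
    by_cases hv : v ∈ A
    · simp [Equiv.sumCompl_symm_apply_of_pos, hv]
    · simpa [Equiv.sumCompl_symm_apply_of_neg, hv] using (e₂ ⟨v, hv⟩).2
  have hswap : ∀ a b w : W, a ∈ B → b ∈ B → (Equiv.swap a b w ∈ B ↔ w ∈ B) := by
    intro a b w ha hb
    rw [Equiv.swap_apply_def]
    split_ifs <;> simp_all
  let e₁ := e₀.trans (Equiv.swap (e₀ p) p')
  have he₁ : ∀ v, e₁ v ∈ B ↔ v ∈ A := fun v ↦
    (hswap _ _ _ ((he₀ p).1 hA.left_mem) hB.left_mem).trans (he₀ v).symm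
  have he₁p : e₁ p = p' := by simp [e₁]
  let e := e₁.trans (Equiv.swap (e₁ q) q')
  have he : ∀ v, e v ∈ B ↔ v ∈ A := fun v ↦
    (hswap _ _ _ ((he₁ q).2 hA.right_mem) hB.right_mem).trans (he₁ v)
  have heq : e q = q' := by simp [e]
  have hep : e p = p' := by
    change Equiv.swap (e₁ q) q' (e₁ p) = p'
    rw [he₁p, Equiv.swap_apply_of_ne_of_ne _ hB.ne]
    rw [← he₁p]
    exact e₁.injective.ne hA.ne
  refine ⟨⟨e, fun {u v} ↦ ?_⟩⟩
  rw [hA.adj_iff u (mem_univ _) v (mem_univ _), hB.adj_iff _ (mem_univ _) _ (mem_univ _), he, he,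
    ← hep, ← heq]
  simp only [e.injective.eq_iff]

lemma of_iso (hH : H.IsBalancedPlusEdge univ) (φ : G ≃g H) : G.IsBalancedPlusEdge univ := by
  obtain ⟨A, p, q, hA, hAcard⟩ := hH
  refine ⟨A.map φ.symm.toEquiv.toEmbedding, φ.symm p, φ.symm q, ⟨subset_univ _, ?_, ?_, ?_, ?_⟩, ?_⟩
  · exact mem_map_of_mem _ hA.left_mem
  · exact mem_map_of_mem _ hA.right_mem
  · exact φ.symm.injective.ne hA.ne
  · intro u _ v _
    rw [← φ.map_adj_iff, hA.adj_iff _ (mem_univ _) _ (mem_univ _)]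
    have h1 : ∀ u, u ∈ A.map φ.symm.toEquiv.toEmbedding ↔ φ u ∈ A := fun u ↦ by
      rw [mem_map_equiv]
      rfl
    have h2 : ∀ u w, u = φ.symm w ↔ φ u = w := fun u w ↦ φ.toEquiv.eq_symm_apply
    simp only [h1, h2]
  · rw [card_map, hAcard, card_univ, card_univ, Fintype.card_congr φ.toEquiv]

end IsBalancedPlusEdge

lemma isBipartitePlusEdge_Kplus {n : ℕ} (hn : 3 ≤ n) :
    (Kplus n).IsBipartitePlusEdge univ {v | (v : ℕ) < (n + 1) / 2} ⟨0, by omega⟩ ⟨1, by omega⟩ where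
  subset := subset_univ _
  left_mem := by simp; omega
  right_mem := by simp; omega
  ne := by simp
  adj_iff u _ v _ := by
    simp only [Kplus, KbipPlus, fromRel_adj, ne_eq, Fin.ext_iff, mem_filter_univ]
    omega

lemma card_filter_val_lt {n a : ℕ} (ha : a ≤ n) : #{v : Fin n | (v : ℕ) < a} = a := by
  rw [Fin.card_filter_val_lt, min_eq_right ha]

lemma isBalancedPlusEdge_Kplus {n : ℕ} (hn : 3 ≤ n) : (Kplus n).IsBalancedPlusEdge univ :=
  ⟨_, _, _, isBipartitePlusEdge_Kplus hn, by
    rw [card_filter_val_lt (by omega), card_univ, Fintype.card_fin]⟩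

lemma isBalancedPlusEdge_of_card_trianglesIn_le {n : ℕ} (hn : 3 ≤ n) {G : SimpleGraph (Fin n)}
    (h : specRad (Kplus n) ≤ specRad G) (ht : #(G.trianglesIn univ) ≤ n / 2) :
    G.IsBalancedPlusEdge univ := by
  classical
  refine erdosRademacherAt hn G univ (by simp) ?_ ht
  by_contra! hE
  have hEN : G.degSum univ ≤ 2 * ((n + 1) / 2 * (n / 2)) := by
    obtain ⟨m, hm⟩ := G.even_degSum (S := univ)
    omega
  have hEN' : (G.degSum univ : ℝ) ≤ 2 * (((n + 1) / 2 : ℕ) * (n / 2 : ℕ)) := by exact_mod_cast hEN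
  obtain ⟨r, c, hr, hc, hrK, hrc, hlt⟩ := exists_spectral_parameters hn
  have hcard : #({v : Fin n | (v : ℕ) < (n + 1) / 2} : Finset (Fin n)) = (n + 1) / 2 :=
    card_filter_val_lt (by omega)
  have hcard' : #({v : Fin n | (v : ℕ) < (n + 1) / 2} : Finset (Fin n))ᶜ = n / 2 := by
    rw [card_compl, hcard, Fintype.card_fin]
    omega
  have hrG : r ≤ specRad G := ((isBipartitePlusEdge_Kplus hn).le_specRad
    (by rw [hcard']; omega) hr (by rw [hcard, hcard']; exact hrK)).trans h
  have : Nonempty (Fin n) := ⟨⟨0, by omega⟩⟩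
  obtain ⟨i, hi⟩ := exists_eigenvalues_eq_specRad G
  have hsq : r ^ 2 ≤ specRad G ^ 2 := by gcongr
  have hmoment := (G.isHermitian_adjMatrix ℝ).le_trace_pow_three i hc (by
    rw [trace_adjMatrix_sq, hi]
    linarith)
  rw [trace_adjMatrix_sq, hi] at hmoment
  have htri := G.trace_adjMatrix_pow_three_le
  have ht' : (#(G.trianglesIn univ) : ℝ) ≤ (n / 2 : ℕ) := by exact_mod_cast ht
  have hmono : r ^ 2 * (r + c) ≤ specRad G ^ 2 * (specRad G + c) := by gcongr
  nlinarith [mul_le_mul_of_nonneg_left hEN' hc]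

end SimpleGraph

/-- **A spectral Erdős–Rademacher theorem.** If `G` is a graph on `n ≥ 3` vertices with
`λ(G) ≥ λ(K⁺_{⌈n/2⌉,⌊n/2⌋})`, then `G` has at least `⌊n/2⌋` triangles, with equality
if and only if `G` is isomorphic to `K⁺_{⌈n/2⌉,⌊n/2⌋}`. -/
theorem spectral_erdos_rademacher (n : ℕ) (hn : 3 ≤ n) (G : SimpleGraph (Fin n))
    (h : specRad (Kplus n) ≤ specRad G) :
    n / 2 ≤ triangleCount G ∧
      (triangleCount G = n / 2 ↔ Nonempty (G ≃g Kplus n)) := by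
  rw [G.triangleCount_eq_card_trianglesIn]
  have hcard : (Finset.univ : Finset (Fin n)).card / 2 = n / 2 := by simp
  have key : (G.trianglesIn Finset.univ).card ≤ n / 2 → G.IsBalancedPlusEdge Finset.univ :=
    SimpleGraph.isBalancedPlusEdge_of_card_trianglesIn_le hn h
  refine ⟨?_, fun ht ↦ (key ht.le).nonempty_iso (SimpleGraph.isBalancedPlusEdge_Kplus hn) rfl, ?_⟩
  · by_contra! hlt
    exact hlt.not_ge (hcard ▸ (key hlt.le).le_card_trianglesIn)
  · rintro ⟨φ⟩
    have hG := (SimpleGraph.isBalancedPlusEdge_Kplus hn).of_iso φ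
    exact hcard ▸ le_antisymm hG.card_trianglesIn_le hG.le_card_trianglesIn
end

section
/- Let n ≥ 4 be an even integer. Then λ(K⁺_{n/2,n/2}) is the largest real root of the polynomial f(x) = x³ − x² − (n²/4)x + n²/4 − n. -/
open Matrix

/-- A nonnegative real matrix with a positive eigenvector for `r` has all its real
eigenvalues at most `r`. -/
theorem eigenvalue_le_of_pos_eigenvector {V : Type*} [Fintype V] (A : Matrix V V ℝ)
    (hA : ∀ i j, 0 ≤ A i j) {v w : V → ℝ} {r μ : ℝ} (hv : ∀ i, 0 < v i)
    (hAv : A *ᵥ v = r • v) (hw : w ≠ 0) (hAw : A *ᵥ w = μ • w) : μ ≤ r := by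
  obtain ⟨i₀, hi₀⟩ := Function.ne_iff.mp hw
  have : Nonempty V := ⟨i₀⟩
  obtain ⟨i, hi⟩ := Finite.exists_max fun j => |w j| / v j
  have hwi : 0 < |w i| := by
    have h := (div_pos (abs_pos.mpr hi₀) (hv i₀)).trans_le (hi i₀)
    exact (div_pos_iff_of_pos_right (hv i)).mp h
  refine le_of_mul_le_mul_right ?_ hwi
  have hwv : ∀ j, |w j| ≤ |w i| / v i * v j := fun j => (div_le_iff₀ (hv j)).mp (hi j)
  have hAvi : ∑ j, A i j * v j = r * v i := congrFun hAv i
  have hAwi : ∑ j, A i j * w j = μ * w i := congrFun hAw i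
  calc μ * |w i| ≤ |μ| * |w i| := by gcongr; exact le_abs_self μ
    _ = |∑ j, A i j * w j| := by rw [hAwi, abs_mul]
    _ ≤ ∑ j, |A i j * w j| := Finset.abs_sum_le_sum_abs _ _
    _ ≤ ∑ j, |w i| / v i * (A i j * v j) := by
      refine Finset.sum_le_sum fun j _ => ?_
      rw [abs_mul, abs_of_nonneg (hA i j), mul_left_comm]
      exact mul_le_mul_of_nonneg_left (hwv j) (hA i j)
    _ = r * |w i| := by
      rw [← Finset.mul_sum, hAvi]
      field_simp [(hv i).ne']

/-- A positive eigenvector of the adjacency matrix belongs to the spectral radius. -/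
theorem specRad_eq_of_pos_eigenvector {V : Type*} [Fintype V] [Nonempty V]
    (G : SimpleGraph V) [DecidableRel G.Adj] {v : V → ℝ} {r : ℝ} (hv : ∀ i, 0 < v i)
    (h : ∀ i, (∑ j, if G.Adj i j then v j else 0) = r * v i) : specRad G = r := by
  obtain rfl : ‹DecidableRel G.Adj› = Classical.decRel G.Adj := Subsingleton.elim _ _
  let := Classical.decRel G.Adj
  let := Classical.decEq V
  have hAv : G.adjMatrix ℝ *ᵥ v = r • v := by
    ext i
    simpa [Matrix.mulVec, dotProduct, SimpleGraph.adjMatrix_apply] using h i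
  have hmax : IsGreatest
      {μ : ℝ | Module.End.HasEigenvalue (Matrix.toLin' (G.adjMatrix ℝ)) μ} r := by
    constructor
    · refine Module.End.hasEigenvalue_of_hasEigenvector (x := v) ?_
      refine Module.End.hasEigenvector_iff.mpr ⟨?_, ?_⟩
      · rwa [Module.End.mem_eigenspace_iff, Matrix.toLin'_apply]
      · obtain ⟨i⟩ := ‹Nonempty V›
        exact fun h0 => (hv i).ne' (congrFun h0 i)
    · rintro μ hμ
      obtain ⟨w, hw, hw0⟩ := hμ.exists_hasEigenvector
      rw [Module.End.mem_eigenspace_iff, Matrix.toLin'_apply] at hw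
      refine eigenvalue_le_of_pos_eigenvector _ (fun i j => ?_) hv hAv hw0 hw
      rw [SimpleGraph.adjMatrix_apply]
      split_ifs <;> norm_num
  exact hmax.csSup_eq

theorem KbipPlus_adj {n a : ℕ} (ha : 2 ≤ a) (i j : Fin n) :
    (KbipPlus n a).Adj i j ↔
      if (i : ℕ) < a then a ≤ (j : ℕ) ∨ (i : ℕ) + j = 1 else (j : ℕ) < a := by
  simp only [KbipPlus, SimpleGraph.fromRel_adj, ne_eq, Fin.ext_iff]
  split_ifs <;> omega

/-- Every root larger than `m` of the characteristic cubic of the quotient matrix of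
`K⁺_{m,m}` equals its spectral radius. -/
theorem specRad_KbipPlus_eq {m : ℕ} (hm : 2 ≤ m) {r : ℝ} (hr : (m : ℝ) < r)
    (hroot : r ^ 3 - r ^ 2 - (m : ℝ) ^ 2 * r + (m : ℝ) ^ 2 - 2 * m = 0) :
    specRad (KbipPlus (m + m) m) = r := by
  classical
  obtain ⟨k, rfl⟩ := Nat.exists_eq_add_of_le' hm
  have hk : (0 : ℝ) ≤ k := k.cast_nonneg
  push_cast at hr hroot
  have hr1 : 0 < r - 1 := by linarith
  have hr0 : 0 < r := by linarith
  obtain ⟨f, hf⟩ : ∃ f : ℕ → ℝ, f = fun j => if j < 2 then (k + 2) * r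
    else if j < k + 2 then (k + 2) * (r - 1) else r * (r - 1) := ⟨_, rfl⟩
  have : Nonempty (Fin (k + 2 + (k + 2))) := ⟨⟨0, by omega⟩⟩
  refine specRad_eq_of_pos_eigenvector (KbipPlus (k + 2 + (k + 2)) (k + 2))
    (v := fun j : Fin (k + 2 + (k + 2)) => f (j : ℕ)) (fun j => ?_) fun i => ?_
  · simp only [hf]
    split_ifs <;> positivity
  · simp only [KbipPlus_adj hm]
    rw [Fin.sum_univ_eq_sum_range (fun j => if (if (i : ℕ) < k + 2 then
      k + 2 ≤ j ∨ (i : ℕ) + j = 1 else j < k + 2) then f j else 0), Finset.sum_range_add]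
    have hB : ∀ j, f (k + 2 + j) = r * (r - 1) := fun j => by
      simp only [hf]
      rw [if_neg (by omega), if_neg (by omega)]
    have hA : ∀ j ∈ Finset.range k, f (j + 2) = (k + 2) * (r - 1) := fun j hj => by
      have := Finset.mem_range.mp hj
      simp only [hf]
      rw [if_neg (by omega), if_pos (by omega)]
    have h0 : f 0 = (k + 2) * r := by simp [hf]
    have h1 : f 1 = (k + 2) * r := by simp [hf]
    by_cases hi : (i : ℕ) < k + 2
    · simp only [hi, if_true, Nat.le_add_right, true_or, hB, Finset.sum_const,
        Finset.card_range, nsmul_eq_mul]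
      rw [Finset.sum_range_succ', Finset.sum_range_succ',
        Finset.sum_eq_zero fun j hj => if_neg (by have := Finset.mem_range.mp hj; omega)]
      rcases (by omega : (i : ℕ) = 0 ∨ (i : ℕ) = 1 ∨ 2 ≤ (i : ℕ)) with h | h | h
      · simp [h, h0, h1]; ring
      · simp [h, h0, h1]; ring
      · have hfi : f i = (k + 2) * (r - 1) := by
          simp only [hf]
          rw [if_neg (by omega), if_pos hi]
        rw [hfi, if_neg (by omega), if_neg (by omega)]
        push_cast
        ring
    · have hfi : f i = r * (r - 1) := by
        simp only [hf]
        rw [if_neg (by omega), if_neg hi]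
      simp only [hi, if_false]
      rw [hfi, Finset.sum_congr rfl fun j hj => if_pos (Finset.mem_range.mp hj),
        Finset.sum_eq_zero fun j hj => if_neg (by omega),
        Finset.sum_range_succ', Finset.sum_range_succ', Finset.sum_congr rfl hA]
      simp only [Finset.sum_const, Finset.card_range, nsmul_eq_mul, zero_add, h0, h1]
      linear_combination -hroot

/-- The cubic is negative at `m` and positive at `m + 2`. -/
theorem exists_root_gt {m : ℝ} (hm : 2 ≤ m) :
    ∃ r, m < r ∧ r ^ 3 - r ^ 2 - m ^ 2 * r + m ^ 2 - 2 * m = 0 := by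
  have hc : ContinuousOn (fun r : ℝ => r ^ 3 - r ^ 2 - m ^ 2 * r + m ^ 2 - 2 * m)
      (Set.Icc m (m + 2)) := by fun_prop
  obtain ⟨r, hr, h⟩ := intermediate_value_Ioo (by linarith : m ≤ m + 2) hc
    (show (0 : ℝ) ∈ Set.Ioo _ _ from ⟨by nlinarith, by nlinarith⟩)
  exact ⟨r, hr.1, h⟩

/-- For even `n ≥ 4`, `λ(K⁺_{n/2,n/2})` is the largest real root of
`f(x) = x³ − x² − (n²/4)x + n²/4 − n`. -/
theorem specRad_Kplus_even_root (n : ℕ) (hn : 4 ≤ n) (he : Even n) :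
    (specRad (Kplus n)) ^ 3 - (specRad (Kplus n)) ^ 2
        - ((n : ℝ) ^ 2 / 4) * specRad (Kplus n) + (n : ℝ) ^ 2 / 4 - (n : ℝ) = 0 ∧
      ∀ x : ℝ, x ^ 3 - x ^ 2 - ((n : ℝ) ^ 2 / 4) * x + (n : ℝ) ^ 2 / 4 - (n : ℝ) = 0 →
        x ≤ specRad (Kplus n) := by
  obtain ⟨m, rfl⟩ := he
  have hm : 2 ≤ m := by omega
  have hmR : (2 : ℝ) ≤ m := by exact_mod_cast hm
  have hK : Kplus (m + m) = KbipPlus (m + m) m := by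
    rw [Kplus, show (m + m + 1) / 2 = m by omega]
  obtain ⟨r, hr, hroot⟩ := exists_root_gt hmR
  rw [hK, specRad_KbipPlus_eq hm hr hroot]
  push_cast
  refine ⟨by linear_combination hroot, fun x hx => ?_⟩
  rcases le_or_gt x m with h | h
  · exact h.trans hr.le
  · rw [← specRad_KbipPlus_eq hm hr hroot,
      specRad_KbipPlus_eq hm h (by linear_combination hx)]
end

section
/- For every integer n ≥ 4, the spectral radius of K⁺_{⌈n/2⌉,⌊n/2⌋} satisfies λ(K⁺_{⌈n/2⌉,⌊n/2⌋})² > ⌊n²/4⌋ + 2. -/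
open Matrix

/-- Splitting a sum over `2 + c + b` vertices into the two special vertices, the `c` vertices
following them, and the last `b` vertices, on each of which the summand is constant. -/
lemma sum_fin_two_add_add (c b : ℕ) (F : ℕ → ℝ) (q r : ℝ)
    (hq : ∀ i < c, F (2 + i) = q) (hr : ∀ i < b, F (2 + c + i) = r) :
    ∑ v : Fin (2 + c + b), F v = F 0 + F 1 + c * q + b * r := by
  rw [Fin.sum_univ_eq_sum_range F, Finset.sum_range_add, Finset.sum_range_add,
    Finset.sum_congr rfl fun i hi => hq i (Finset.mem_range.mp hi),
    Finset.sum_congr rfl fun i hi => hr i (Finset.mem_range.mp hi)]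
  simp [Finset.sum_range_succ]

lemma KbipPlus_adj_iff (n a : ℕ) (ha : 2 ≤ a) (u v : Fin n) :
    (KbipPlus n a).Adj u v ↔
      ((u : ℕ) < a ∧ a ≤ (v : ℕ)) ∨ ((v : ℕ) < a ∧ a ≤ (u : ℕ)) ∨
        ((u : ℕ) = 0 ∧ (v : ℕ) = 1) ∨ ((u : ℕ) = 1 ∧ (v : ℕ) = 0) := by
  simp only [KbipPlus, SimpleGraph.fromRel_adj, ne_eq, Fin.ext_iff]
  omega

/-- Every eigenvalue of the adjacency matrix is at most `specRad`. -/
lemma le_specRad_of_eigenvector {V : Type*} [Fintype V] (G : SimpleGraph V) (μ : ℝ) (f : V → ℝ)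
    (hf : f ≠ 0)
    (h : ∀ u, (∑ v, open Classical in if G.Adj u v then f v else 0) = μ * f u) :
    μ ≤ specRad G := by
  classical
  refine le_csSup (Set.Finite.bddAbove (Module.End.finite_hasEigenvalue _)) ?_
  refine Module.End.hasEigenvalue_of_hasEigenvector (x := f) ⟨?_, hf⟩
  rw [Module.End.mem_eigenspace_iff]
  ext u
  simp only [Matrix.toLin'_apply, Matrix.mulVec, dotProduct, SimpleGraph.adjMatrix_apply,
    Pi.smul_apply, smul_eq_mul, ite_mul, one_mul, zero_mul]
  rw [← h u]

/-- Roots of the characteristic polynomial of the quotient matrix of `KbipPlus` bound the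
spectral radius from below. -/
lemma le_specRad_KbipPlus (c b : ℕ) (hb : 0 < b) (μ : ℝ) (hμ : 1 < μ)
    (hroot : μ ^ 3 - μ ^ 2 - (2 + c) * b * μ + c * b = 0) :
    μ ≤ specRad (KbipPlus (2 + c + b) (2 + c)) := by
  classical
  let g : ℕ → ℝ := fun i =>
    if i < 2 then b * μ else if i < 2 + c then b * (μ - 1) else μ * (μ - 1)
  refine le_specRad_of_eigenvector _ μ (fun v => g v) (fun h => ?_) fun u => ?_
  · have h0 := congrFun h ⟨0, by omega⟩
    have hb' : (0 : ℝ) < b := by exact_mod_cast hb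
    have : (0 : ℝ) < b * μ := by positivity
    simp [g] at h0
    rcases h0 with h0 | h0
    · omega
    · linarith
  · let F : ℕ → ℝ := fun v =>
      if ((u : ℕ) < 2 + c ∧ 2 + c ≤ v) ∨ (v < 2 + c ∧ 2 + c ≤ (u : ℕ)) ∨
        ((u : ℕ) = 0 ∧ v = 1) ∨ ((u : ℕ) = 1 ∧ v = 0) then g v else 0
    have hF : (∑ v : Fin (2 + c + b),
        if (KbipPlus (2 + c + b) (2 + c)).Adj u v then g v else 0) =
          ∑ v : Fin (2 + c + b), F v :=
      Finset.sum_congr rfl fun v _ => by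
        simp only [F, KbipPlus_adj_iff _ _ (Nat.le_add_right 2 c)]
    rw [hF, sum_fin_two_add_add c b F
      (if (u : ℕ) < 2 + c then 0 else b * (μ - 1)) (if (u : ℕ) < 2 + c then μ * (μ - 1) else 0)
      (fun i hi => by grind) (fun i hi => by grind)]
    have hc1 : ¬ 2 + c ≤ 1 := by omega
    have hc2 : 1 < 2 + c := by omega
    by_cases h2 : (u : ℕ) ≤ 1
    · obtain h0 | h1 : (u : ℕ) = 0 ∨ (u : ℕ) = 1 := by omega
      · simp [F, g, h0]
        ring
      · simp [F, g, h1, hc1, hc2]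
        ring
    · by_cases h3 : (u : ℕ) < 2 + c
      · have hc : ¬ 2 + c ≤ (u : ℕ) := by omega
        have hu0 : (u : ℕ) ≠ 0 := by omega
        have hu1 : (u : ℕ) ≠ 1 := by omega
        simp [F, g, h2, h3, hc, hc1, hu0, hu1]
        ring
      · have hc : 2 + c ≤ (u : ℕ) := by omega
        simp [F, g, h2, h3, hc, hc2]
        linear_combination -hroot

lemma lt_specRad_KbipPlus_sq (c b : ℕ) (hb : 0 < b)
    (h : (2 + c) * b + 2 < (b + 1) ^ 2) :
    (((2 + c) * b : ℕ) : ℝ) + 2 < specRad (KbipPlus (2 + c + b) (2 + c)) ^ 2 := by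
  set s : ℝ := √(((2 + c) * b : ℕ) + 2) with hs
  have hs2 : s ^ 2 = (2 + c) * b + 2 := by
    rw [hs, Real.sq_sqrt (by positivity)]; push_cast; ring
  have hs0 : 0 ≤ s := Real.sqrt_nonneg _
  have hcb : (0 : ℝ) ≤ c * b := by positivity
  have hb' : (1 : ℝ) ≤ b := by exact_mod_cast hb
  have hR : ((2 + c) * b + 2 : ℝ) < (b + 1) ^ 2 := by exact_mod_cast h
  have hs1 : 1 < s := by nlinarith
  have hsb : s < b + 1 := lt_of_pow_lt_pow_left₀ 2 (by positivity) (hs2 ▸ hR)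
  let p : ℝ → ℝ := fun x => x ^ 3 - x ^ 2 - (2 + c) * b * x + c * b
  have hp : Continuous p := by fun_prop
  have hps : p s < 0 := by
    have : p s = 2 * s - 2 - 2 * b := by
      simp only [p]; linear_combination (s - 1) * hs2
    linarith
  have hpb : 0 ≤ p (b + 2) := by
    have : p (b + 2) = (b + 2) * ((b + 2) * (b + 1) - (2 + c) * b) + c * b := by
      simp only [p]; ring
    rw [this]
    have : (0 : ℝ) ≤ (b + 2) * (b + 1) - (2 + c) * b := by nlinarith
    positivity
  obtain ⟨μ, ⟨hsμ, -⟩, hμ⟩ := intermediate_value_Icc (by linarith : s ≤ b + 2) hp.continuousOn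
    (show (0 : ℝ) ∈ Set.Icc (p s) (p (b + 2)) from ⟨hps.le, hpb⟩)
  have hlt : s < μ := lt_of_le_of_ne hsμ fun e => by rw [e, hμ] at hps; exact hps.false
  have hle := le_specRad_KbipPlus c b hb μ (by linarith) hμ
  calc (((2 + c) * b : ℕ) : ℝ) + 2 = s ^ 2 := by rw [hs2]; push_cast; ring
    _ < _ := by gcongr; linarith

/-- For every `n ≥ 4`, `λ(K⁺_{⌈n/2⌉,⌊n/2⌋})² > ⌊n²/4⌋ + 2`. -/
theorem specRad_Kplus_sq_gt (n : ℕ) (hn : 4 ≤ n) :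
    ((n ^ 2 / 4 : ℕ) : ℝ) + 2 < (specRad (Kplus n)) ^ 2 := by
  obtain ⟨c, b, hb, rfl, hcb⟩ : ∃ c b, 2 ≤ b ∧ n = 2 + c + b ∧ (2 + c = b ∨ 2 + c = b + 1) :=
    ⟨(n + 1) / 2 - 2, n / 2, by omega, by omega, by omega⟩
  have ha : (2 + c + b + 1) / 2 = 2 + c := by omega
  have hsq : (2 + c + b) ^ 2 / 4 = (2 + c) * b := by
    rcases hcb with h | h <;> rw [h]
    · rw [show (b + b) ^ 2 = 4 * (b * b) by ring]; omega
    · rw [show (b + 1 + b) ^ 2 = 4 * ((b + 1) * b) + 1 by ring]; omega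
  rw [Kplus, ha, hsq]
  exact lt_specRad_KbipPlus_sq c b (by omega) (by rcases hcb with h | h <;> rw [h] <;> nlinarith)
end

section
/- Let G be a connected simple graph on n vertices, let x be a positive eigenvector of the adjacency matrix of G for the eigenvalue λ(G), and let u and v be vertices with x_u ≥ x_v. Let S be a nonempty subset of N(v) ∖ N(u) with u ∉ S, and let G* be the graph obtained from G by deleting all edges {v,w} with w ∈ S and adding all edges {u,w} with w ∈ S. Then λ(G) < λ(G*). -/
open Matrix

/-- `c • 1 - A` is positive semidefinite when `c` bounds the eigenvalues of the real
symmetric matrix `A`. -/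
theorem Matrix.IsHermitian.posSemidef_smul_one_sub {V : Type*} [Fintype V] [DecidableEq V]
    {A : Matrix V V ℝ} (hA : A.IsHermitian) {c : ℝ}
    (hc : ∀ μ, Module.End.HasEigenvalue (Matrix.toLin' A) μ → μ ≤ c) :
    (c • (1 : Matrix V V ℝ) - A).PosSemidef := by
  have hB : (c • (1 : Matrix V V ℝ) - A).IsHermitian :=
    (isHermitian_one.smul (IsSelfAdjoint.all c)).sub hA
  rw [hB.posSemidef_iff_eigenvalues_nonneg]
  intro i
  have hv := hB.mulVec_eigenvectorBasis i
  have hne : (hB.eigenvectorBasis i).ofLp ≠ 0 := fun h =>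
    hB.eigenvectorBasis.orthonormal.ne_zero i (by ext j; exact congrFun h j)
  have hev : A *ᵥ (hB.eigenvectorBasis i).ofLp =
      (c - hB.eigenvalues i) • (hB.eigenvectorBasis i).ofLp := by
    rw [sub_mulVec, smul_mulVec, one_mulVec] at hv
    rw [sub_smul, ← hv, sub_sub_cancel]
  have := hc _ (Module.End.hasEigenvalue_of_hasEigenvector
    ⟨Module.End.mem_eigenspace_iff.2 (by rw [toLin'_apply, hev]), hne⟩)
  simpa using this

theorem SimpleGraph.posSemidef_specRad_smul_one_sub_adjMatrix {V : Type*} [Fintype V]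
    [DecidableEq V] (G : SimpleGraph V) [DecidableRel G.Adj] :
    (specRad G • (1 : Matrix V V ℝ) - G.adjMatrix ℝ).PosSemidef := by
  apply Matrix.IsHermitian.posSemidef_smul_one_sub
  · rw [IsHermitian, conjTranspose_eq_transpose_of_trivial, G.transpose_adjMatrix]
  · intro μ hμ
    have hbdd : BddAbove {μ : ℝ | Module.End.HasEigenvalue (toLin' (G.adjMatrix ℝ)) μ} :=
      (Module.End.finite_hasEigenvalue _).bddAbove
    have h : specRad G =
        sSup {μ : ℝ | Module.End.HasEigenvalue (toLin' (G.adjMatrix ℝ)) μ} := by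
      unfold specRad
      congr!
    exact h ▸ le_csSup hbdd hμ

/-- The adjacency matrix after moving the edges from `v` to `S` over to `u` is a rank-two
perturbation of the original one. -/
theorem SimpleGraph.adjMatrix_rotation {V : Type*} [DecidableEq V]
    (G : SimpleGraph V) [DecidableRel G.Adj] {u v : V} {S : Set V} [DecidablePred (· ∈ S)]
    (hS : S.Nonempty) (hSsub : S ⊆ G.neighborSet v \ G.neighborSet u) (huS : u ∉ S)
    [DecidableRel (fromEdgeSet
      ((G.edgeSet \ {e | ∃ w ∈ S, e = s(v, w)}) ∪ {e | ∃ w ∈ S, e = s(u, w)})).Adj] :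
    (fromEdgeSet ((G.edgeSet \ {e | ∃ w ∈ S, e = s(v, w)}) ∪
        {e | ∃ w ∈ S, e = s(u, w)})).adjMatrix ℝ =
      G.adjMatrix ℝ + vecMulVec (Pi.single u 1 - Pi.single v 1) (S.indicator 1) +
        vecMulVec (S.indicator 1) (Pi.single u 1 - Pi.single v 1) := by
  have hv : ∀ w ∈ S, G.Adj v w := fun w hw => (hSsub hw).1
  have hu : ∀ w ∈ S, ¬ G.Adj u w := fun w hw => (hSsub hw).2
  have huv : u ≠ v := by
    rintro rfl
    obtain ⟨w, hw⟩ := hS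
    exact hu w hw (hv w hw)
  have hvS : v ∉ S := fun h => G.irrefl (hv v h)
  ext i j
  have hadj : (fromEdgeSet ((G.edgeSet \ {e | ∃ w ∈ S, e = s(v, w)}) ∪
      {e | ∃ w ∈ S, e = s(u, w)})).Adj i j ↔
      (G.Adj i j ∧ ¬ (i = v ∧ j ∈ S) ∧ ¬ (j = v ∧ i ∈ S)) ∨
        (i = u ∧ j ∈ S) ∨ (j = u ∧ i ∈ S) := by
    have key : ∀ a, (∃ w ∈ S, s(i, j) = s(a, w)) ↔ (i = a ∧ j ∈ S) ∨ (j = a ∧ i ∈ S) := by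
      intro a
      simp only [Sym2.eq_iff]
      grind
    have := G.ne_of_adj (a := i) (b := j)
    simp only [fromEdgeSet_adj, Set.mem_union, Set.mem_sdiff, Set.mem_ofPred_eq, key, mem_edgeSet]
    grind
  have hsymm := G.adj_comm i j
  simp only [adjMatrix_apply, hadj, Matrix.add_apply, vecMulVec_apply, Pi.sub_apply,
    Pi.single_apply, Set.indicator_apply, Pi.one_apply]
  grind

/-- **Wu–Xiao–Hong rotation lemma.** Let `G` be a connected graph, `x` a positive
eigenvector of the adjacency matrix for the eigenvalue `λ(G)`, and `u, v` vertices
with `x u ≥ x v`. If `S` is a nonempty subset of `N(v) \ N(u)` with `u ∉ S`, and `G*`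
is obtained from `G` by deleting the edges from `v` to `S` and adding the edges from
`u` to `S`, then `λ(G) < λ(G*)`. -/
theorem specRad_lt_of_rotation {V : Type*} [Fintype V] [DecidableEq V]
    (G : SimpleGraph V) [DecidableRel G.Adj] (hG : G.Connected)
    (x : V → ℝ) (hxpos : ∀ w, 0 < x w)
    (heig : SimpleGraph.adjMatrix ℝ G *ᵥ x = specRad G • x)
    (u v : V) (huv : x v ≤ x u)
    (S : Set V) (hS : S.Nonempty) (hSsub : S ⊆ G.neighborSet v \ G.neighborSet u)
    (huS : u ∉ S) :
    specRad G < specRad (SimpleGraph.fromEdgeSet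
      ((G.edgeSet \ {e | ∃ w ∈ S, e = s(v, w)}) ∪ {e | ∃ w ∈ S, e = s(u, w)})) := by
  classical
  have hM := G.adjMatrix_rotation hS hSsub huS
  set H := SimpleGraph.fromEdgeSet
    ((G.edgeSet \ {e | ∃ w ∈ S, e = s(v, w)}) ∪ {e | ∃ w ∈ S, e = s(u, w)})
  set d : V → ℝ := S.indicator 1
  have hd : 0 < d ⬝ᵥ x := by
    obtain ⟨w, hw⟩ := hS
    refine Finset.sum_pos' (fun i _ => mul_nonneg (Set.indicator_nonneg (by simp) i) (hxpos i).le)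
      ⟨w, Finset.mem_univ w, ?_⟩
    simpa [d, hw] using hxpos w
  have huv' : u ≠ v := by
    rintro rfl
    obtain ⟨w, hw⟩ := hS
    exact (hSsub hw).2 (hSsub hw).1
  have hHx : H.adjMatrix ℝ *ᵥ x = specRad G • x +
      (d ⬝ᵥ x) • (Pi.single u 1 - Pi.single v 1 : V → ℝ) + (x u - x v) • d := by
    rw [hM, add_mulVec, add_mulVec, heig, vecMulVec_mulVec, vecMulVec_mulVec]
    simp only [op_smul_eq_smul, sub_dotProduct, single_dotProduct, one_mul]
  have hxx : 0 < x ⬝ᵥ x :=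
    Finset.sum_pos (fun i _ => mul_pos (hxpos i) (hxpos i)) ⟨u, Finset.mem_univ u⟩
  have hquad : x ⬝ᵥ ((specRad H • (1 : Matrix V V ℝ) - H.adjMatrix ℝ) *ᵥ x) =
      (specRad H - specRad G) * (x ⬝ᵥ x) - 2 * ((d ⬝ᵥ x) * (x u - x v)) := by
    rw [sub_mulVec, smul_mulVec, one_mulVec, hHx]
    simp only [dotProduct_sub, dotProduct_add, dotProduct_smul, smul_eq_mul, dotProduct_single,
      mul_one, dotProduct_comm x d]
    ring
  have hpsd := H.posSemidef_specRad_smul_one_sub_adjMatrix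
  have hnonneg := hpsd.dotProduct_mulVec_nonneg x
  rw [star_trivial, hquad] at hnonneg
  by_contra! hle
  have hprod : 0 ≤ (d ⬝ᵥ x) * (x u - x v) := mul_nonneg hd.le (sub_nonneg.2 huv)
  have hmul : (specRad H - specRad G) * (x ⬝ᵥ x) ≤ 0 :=
    mul_nonpos_of_nonpos_of_nonneg (sub_nonpos.2 hle) hxx.le
  have hker := (hpsd.dotProduct_mulVec_zero_iff x).1 (by rw [star_trivial, hquad]; linarith)
  rw [sub_mulVec, smul_mulVec, one_mulVec, hHx] at hker
  have hu := congrFun hker u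
  simp [d, huS, huv'] at hu
  nlinarith [mul_le_mul_of_nonneg_right hle (hxpos u).le]
end

section
/- Let n ≥ 4 be an even integer, and let K⁺_{n/2+1,n/2−1} be the graph on n vertices obtained from the complete bipartite graph with parts of sizes n/2 + 1 and n/2 − 1 by adding exactly one edge inside the part of size n/2 + 1. Then λ(K⁺_{n/2+1,n/2−1}) is the largest real root of the polynomial f₁(x) = x³ − x² + (1 − n²/4)x + n²/4 − n + 1. -/
open Matrix

namespace KbipPlus

variable {n a : ℕ}

theorem adj_iff (u w : Fin n) :
    (KbipPlus n a).Adj u w ↔ ((u : ℕ) < a ∧ a ≤ (w : ℕ)) ∨ ((w : ℕ) < a ∧ a ≤ (u : ℕ)) ∨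
      ((u : ℕ) = 0 ∧ (w : ℕ) = 1) ∨ ((w : ℕ) = 0 ∧ (u : ℕ) = 1) := by
  rw [KbipPlus, SimpleGraph.fromRel_adj, Ne, Fin.ext_iff]
  omega

/-- The sum of the entries of a vector over the first part. -/
noncomputable def leftSum (a : ℕ) (v : Fin n → ℝ) : ℝ := ∑ w : Fin n, if (w : ℕ) < a then v w else 0

/-- The sum of the entries of a vector over the second part. -/
noncomputable def rightSum (a : ℕ) (v : Fin n → ℝ) : ℝ := ∑ w : Fin n, if a ≤ (w : ℕ) then v w else 0

theorem adjMatrix_mulVec (ha : 2 ≤ a) (han : a < n) [DecidableRel (KbipPlus n a).Adj]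
    (v : Fin n → ℝ) (u : Fin n) :
    ((KbipPlus n a).adjMatrix ℝ *ᵥ v) u =
      if (u : ℕ) < a then
        rightSum a v + (if (u : ℕ) = 0 then v ⟨1, by omega⟩ else 0)
          + (if (u : ℕ) = 1 then v ⟨0, by omega⟩ else 0)
      else leftSum a v := by
  have h1 : v ⟨1, by omega⟩ = ∑ w : Fin n, if w = ⟨1, by omega⟩ then v w else 0 := by simp
  have h0 : v ⟨0, by omega⟩ = ∑ w : Fin n, if w = ⟨0, by omega⟩ then v w else 0 := by simp
  have hA : ((KbipPlus n a).adjMatrix ℝ *ᵥ v) u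
      = ∑ w, if (KbipPlus n a).Adj u w then v w else 0 := by
    simp [Matrix.mulVec, dotProduct, SimpleGraph.adjMatrix_apply]
  rw [hA]
  split_ifs with hu hu0 hu1 hu1
  · omega
  · rw [h1, rightSum, add_zero, ← Finset.sum_add_distrib]
    refine Finset.sum_congr rfl fun w _ => ?_
    simp only [adj_iff, Fin.ext_iff]
    grind
  · rw [h0, rightSum, add_zero, ← Finset.sum_add_distrib]
    refine Finset.sum_congr rfl fun w _ => ?_
    simp only [adj_iff, Fin.ext_iff]
    grind
  · rw [rightSum, add_zero, add_zero]
    refine Finset.sum_congr rfl fun w _ => ?_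
    simp only [adj_iff]
    grind
  · rw [leftSum]
    refine Finset.sum_congr rfl fun w _ => ?_
    simp only [adj_iff]
    grind

theorem card_left (han : a < n) : (Finset.univ.filter fun w : Fin n => (w : ℕ) < a).card = a := by
  simp [Fin.card_filter_val_lt, han.le]

theorem card_right (han : a < n) :
    (Finset.univ.filter fun w : Fin n => a ≤ (w : ℕ)).card = n - a := by
  have h := Finset.card_filter_add_card_filter_not (s := Finset.univ) fun w : Fin n => (w : ℕ) < a
  rw [card_left han, Finset.card_univ, Fintype.card_fin] at h
  simp only [not_lt] at h
  omega

theorem leftSum_eq (ha : 2 ≤ a) (han : a < n) {v : Fin n → ℝ} {p q : ℝ}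
    (hv : ∀ u : Fin n, (u : ℕ) < a → v u = if (u : ℕ) = 0 ∨ (u : ℕ) = 1 then p else q) :
    leftSum a v = 2 * p + (a - 2) * q := by
  have h : leftSum a v = ∑ w : Fin n, ((if (w : ℕ) < a then q else 0)
      + (if w = ⟨0, by omega⟩ then p - q else 0) + (if w = ⟨1, by omega⟩ then p - q else 0)) := by
    refine Finset.sum_congr rfl fun w _ => ?_
    have := hv w
    simp only [Fin.ext_iff]
    grind
  rw [h, Finset.sum_add_distrib, Finset.sum_add_distrib, ← Finset.sum_filter,
    Finset.sum_const, card_left han]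
  simp
  ring

theorem rightSum_eq (han : a < n) {v : Fin n → ℝ} {r : ℝ}
    (hv : ∀ u : Fin n, a ≤ (u : ℕ) → v u = r) : rightSum a v = (n - a) * r := by
  have h : rightSum a v = ∑ w : Fin n, if a ≤ (w : ℕ) then r else 0 :=
    Finset.sum_congr rfl fun w _ => by have := hv w; grind
  rw [h, ← Finset.sum_filter, Finset.sum_const, card_right han, nsmul_eq_mul, Nat.cast_sub han.le]

/-- Away from `0`, `1` and `-1`, the eigenvalues are the roots of the characteristic polynomial of
the quotient matrix. -/
theorem hasEigenvalue_iff (ha : 2 ≤ a) (han : a < n) [DecidableRel (KbipPlus n a).Adj] {μ : ℝ}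
    (h0 : μ ≠ 0) (h1 : μ ≠ 1) (hneg : μ ≠ -1) :
    Module.End.HasEigenvalue (Matrix.toLin' ((KbipPlus n a).adjMatrix ℝ)) μ ↔
      μ ^ 3 - μ ^ 2 - a * (n - a) * μ + (a - 2) * (n - a) = 0 := by
  have h1' : μ - 1 ≠ 0 := sub_ne_zero.2 h1
  constructor
  · intro h
    obtain ⟨v, hv⟩ := h.exists_hasEigenvector
    have hE : ∀ u, ((KbipPlus n a).adjMatrix ℝ *ᵥ v) u = μ * v u := fun u => by
      have := congrFun hv.apply_eq_smul u
      simpa using this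
    simp only [adjMatrix_mulVec ha han] at hE
    have e0 := hE ⟨0, by omega⟩
    have e1 := hE ⟨1, by omega⟩
    simp [show 0 < a by omega] at e0
    simp [show 1 < a by omega] at e1
    have heq : v ⟨0, by omega⟩ = v ⟨1, by omega⟩ := by
      have : μ + 1 ≠ 0 := fun h => hneg (by linarith)
      apply mul_left_cancel₀ this
      linarith
    have hL : ∀ u : Fin n, (u : ℕ) < a → v u = if (u : ℕ) = 0 ∨ (u : ℕ) = 1 then
        rightSum a v / (μ - 1) else rightSum a v / μ := by
      intro u hu
      split_ifs with h
      · rw [eq_div_iff h1']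
        rcases h with h | h
        · rw [show u = ⟨0, by omega⟩ from Fin.ext h]; linarith
        · rw [show u = ⟨1, by omega⟩ from Fin.ext h]; linarith
      · push Not at h
        have := hE u
        simp [hu, h.1, h.2] at this
        rw [eq_div_iff h0]; linarith
    have hR : ∀ u : Fin n, a ≤ (u : ℕ) → v u = leftSum a v / μ := by
      intro u hu
      have := hE u
      rw [if_neg (by omega)] at this
      rw [eq_div_iff h0]; linarith
    have sL := leftSum_eq ha han hL
    have sR := rightSum_eq han hR
    have hne : rightSum a v ≠ 0 := by
      intro hz
      rw [hz] at sL
      have hz' : leftSum a v = 0 := by simpa using sL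
      apply hv.2
      funext u
      rcases lt_or_ge (u : ℕ) a with hu | hu
      · simp [hL u hu, hz]
      · simp [hR u hu, hz']
    rw [sL] at sR
    field_simp at sR
    linear_combination sR
  · intro hp
    have hpos : (0 : ℝ) < n - a := sub_pos.2 (by exact_mod_cast han)
    let v : Fin n → ℝ := fun u => if (u : ℕ) < a then
      (if (u : ℕ) = 0 ∨ (u : ℕ) = 1 then (n - a) / (μ - 1) else (n - a) / μ) else 1
    have hL := leftSum_eq ha han (v := v) (p := (n - a) / (μ - 1)) (q := (n - a) / μ)
      fun u hu => by simp [v, hu]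
    have hR := rightSum_eq han (v := v) (r := 1) fun u hu => by simp [v, hu]
    refine Module.End.hasEigenvalue_of_hasEigenvector (x := v) ⟨?_, ?_⟩
    · rw [Module.End.mem_eigenspace_iff]
      funext u
      rw [Matrix.toLin'_apply, adjMatrix_mulVec ha han, hL, hR, Pi.smul_apply, smul_eq_mul]
      have ha0 : 0 < a := by omega
      have ha1 : 1 < a := by omega
      by_cases hu : (u : ℕ) < a
      · by_cases hu0 : (u : ℕ) = 0
        · simp [v, hu0, ha0, ha1]
          field_simp
          ring
        · by_cases hu1 : (u : ℕ) = 1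
          · simp [v, hu1, ha0, ha1]
            field_simp
            ring
          · simp [v, hu, hu0, hu1]
            field_simp
      · simp only [v, hu, if_false]
        field_simp
        linear_combination -hp
    · intro hz
      have := congrFun hz ⟨a, han⟩
      simp [v] at this

end KbipPlus

theorem Module.End.isGreatest_sSup_hasEigenvalue {V : Type*} [AddCommGroup V] [Module ℝ V]
    [FiniteDimensional ℝ V] (f : Module.End ℝ V) (hf : ∃ μ, f.HasEigenvalue μ) :
    IsGreatest {μ | f.HasEigenvalue μ} (sSup {μ | f.HasEigenvalue μ}) := by
  have hfin : {μ | f.HasEigenvalue μ}.Finite := f.finite_hasEigenvalue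
  exact ⟨Set.Nonempty.csSup_mem hf hfin, fun μ hμ => le_csSup hfin.bddAbove hμ⟩

/-- For even `n ≥ 4`, `λ(K⁺_{n/2+1,n/2−1})` is the largest real root of
`f₁(x) = x³ − x² + (1 − n²/4)x + n²/4 − n + 1`. -/
theorem specRad_KbipPlus_unbalanced_root (n : ℕ) (hn : 4 ≤ n) (he : Even n) :
    (specRad (KbipPlus n (n / 2 + 1))) ^ 3 - (specRad (KbipPlus n (n / 2 + 1))) ^ 2
        + (1 - (n : ℝ) ^ 2 / 4) * specRad (KbipPlus n (n / 2 + 1))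
        + (n : ℝ) ^ 2 / 4 - (n : ℝ) + 1 = 0 ∧
      ∀ x : ℝ, x ^ 3 - x ^ 2 + (1 - (n : ℝ) ^ 2 / 4) * x
          + (n : ℝ) ^ 2 / 4 - (n : ℝ) + 1 = 0 →
        x ≤ specRad (KbipPlus n (n / 2 + 1)) := by
  obtain ⟨m, rfl⟩ := he
  have hm : 2 ≤ m := by omega
  have hmR : (2 : ℝ) ≤ m := by exact_mod_cast hm
  rw [show (m + m) / 2 + 1 = m + 1 by omega]
  set F : ℝ → ℝ := fun x => x ^ 3 - x ^ 2 + (1 - ((m + m : ℕ) : ℝ) ^ 2 / 4) * x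
    + ((m + m : ℕ) : ℝ) ^ 2 / 4 - ((m + m : ℕ) : ℝ) + 1 with hF
  have hF' : ∀ x, F x = x ^ 3 - x ^ 2 - ((m + 1 : ℕ) : ℝ) * ((m + m : ℕ) - (m + 1 : ℕ)) * x
      + ((m + 1 : ℕ) - 2) * ((m + m : ℕ) - (m + 1 : ℕ)) := fun x => by
    simp only [hF]; push_cast; ring
  let := Classical.decEq (Fin (m + m))
  let := Classical.decRel (KbipPlus (m + m) (m + 1)).Adj
  have key : ∀ {x : ℝ}, 1 < x → (Module.End.HasEigenvalue
      (Matrix.toLin' ((KbipPlus (m + m) (m + 1)).adjMatrix ℝ)) x ↔ F x = 0) := fun {x} hx => by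
    rw [hF']
    exact KbipPlus.hasEigenvalue_iff (by omega) (by omega) (by linarith) (by linarith) (by linarith)
  obtain ⟨r, hr, hr0⟩ : ∃ r, 1 < r ∧ F r = 0 := by
    have hc : ContinuousOn F (Set.Icc 1 (m + 1)) := by fun_prop
    have hF1 : F 1 < 0 := by simp only [hF]; push_cast; nlinarith
    have hF2 : 0 ≤ F (m + 1) := by simp only [hF]; push_cast; nlinarith
    obtain ⟨r, hr, hr0⟩ := intermediate_value_Icc (by linarith) hc ⟨hF1.le, hF2⟩
    exact ⟨r, lt_of_le_of_ne hr.1 fun h => by rw [← h] at hr0; linarith, hr0⟩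
  have hg : IsGreatest _ (specRad (KbipPlus (m + m) (m + 1))) :=
    Module.End.isGreatest_sSup_hasEigenvalue
      (Matrix.toLin' ((KbipPlus (m + m) (m + 1)).adjMatrix ℝ)) ⟨r, (key hr).2 hr0⟩
  have hlt : 1 < specRad (KbipPlus (m + m) (m + 1)) := hr.trans_le (hg.2 ((key hr).2 hr0))
  refine ⟨(key hlt).1 hg.1, fun x hx => ?_⟩
  rcases le_or_gt x 1 with h | h
  · exact h.trans hlt.le
  · exact hg.2 ((key h).2 hx)
end

section
/- Let n ≥ 4 be an even integer, and let K^{+|}_{n/2,n/2} be the graph on n vertices obtained from the complete bipartite graph K_{n/2,n/2} by adding an edge e₁ inside one part and deleting an edge e₂ between the two parts such that e₂ shares an endpoint with e₁. Then λ(K^{+|}_{n/2,n/2}) is the largest real root of the polynomial f₂(x) = x⁴ − (n²/4)x² − (n−2)x + 1 + n²/2 − 2n; moreover λ(K^{+|}_{n/2,n/2}) > n/2 and the number of triangles in K^{+|}_{n/2,n/2} is exactly n/2 − 1. -/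
open Matrix

instance (n a : ℕ) : DecidableRel (KbipPlusMinus n a).Adj := by
  unfold KbipPlusMinus
  infer_instance

/-- Adjacency in `KbipPlusMinus` in terms of the underlying natural numbers. -/
theorem KbipPlusMinus_adj {n a : ℕ} (ha : 2 ≤ a) (u v : Fin n) :
    (KbipPlusMinus n a).Adj u v ↔
      ((u : ℕ) < a ∧ a ≤ (v : ℕ) ∧ ¬((u : ℕ) = 0 ∧ (v : ℕ) = a)) ∨
      ((v : ℕ) < a ∧ a ≤ (u : ℕ) ∧ ¬((v : ℕ) = 0 ∧ (u : ℕ) = a)) ∨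
      ((u : ℕ) = 0 ∧ (v : ℕ) = 1) ∨ ((v : ℕ) = 0 ∧ (u : ℕ) = 1) := by
  simp only [KbipPlusMinus, SimpleGraph.fromRel_adj, ne_eq, Fin.ext_iff]
  omega

theorem adjMatrix_KbipPlusMinus_mulVec {n m : ℕ} (hm : 2 ≤ m) (hn : n = 2 * m)
    (v : Fin n → ℝ) (u : Fin n) :
    ((KbipPlusMinus n m).adjMatrix ℝ *ᵥ v) u =
      if (u : ℕ) < m then
        (∑ w : Fin n, if (w : ℕ) < m then 0 else v w)
          + (if (u : ℕ) = 0 then v ⟨1, by omega⟩ - v ⟨m, by omega⟩ else 0)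
          + (if (u : ℕ) = 1 then v ⟨0, by omega⟩ else 0)
      else
        (∑ w : Fin n, if (w : ℕ) < m then v w else 0)
          - (if (u : ℕ) = m then v ⟨0, by omega⟩ else 0) := by
  have single (c : Fin n) : v c = ∑ w, if w = c then v w else 0 := by simp
  simp only [Matrix.mulVec, dotProduct, SimpleGraph.adjMatrix_apply]
  rw [single ⟨0, by omega⟩, single ⟨1, by omega⟩, single ⟨m, by omega⟩]
  have hsum : ∀ (p : Prop) [Decidable p] (f : Fin n → ℝ),
      (if p then ∑ w, f w else 0) = ∑ w, if p then f w else 0 := by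
    intro p _ f; split_ifs <;> simp
  rw [← Finset.sum_sub_distrib]
  simp only [hsum]
  rw [← Finset.sum_add_distrib, ← Finset.sum_add_distrib, ← Finset.sum_sub_distrib]
  split_ifs with hu <;> refine Finset.sum_congr rfl fun w _ => ?_ <;>
    simp only [KbipPlusMinus_adj hm, Fin.ext_iff] <;> split_ifs <;> first | (exfalso; omega) | simp

theorem sum_ite_lt_half {n m : ℕ} (hn : n = 2 * m) (c : ℝ) :
    (∑ w : Fin n, if (w : ℕ) < m then c else 0) = m * c := by
  subst hn
  rw [Fin.sum_univ_eq_sum_range (fun w => if w < m then c else 0), two_mul, Finset.sum_range_add]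
  rw [Finset.sum_congr rfl (g := fun _ => c) (by intro x hx; simp_all)]
  simp

theorem sum_ite_ge_half {n m : ℕ} (hn : n = 2 * m) (c : ℝ) :
    (∑ w : Fin n, if (w : ℕ) < m then 0 else c) = m * c := by
  subst hn
  rw [Fin.sum_univ_eq_sum_range (fun w => if w < m then 0 else c), two_mul, Finset.sum_range_add]
  rw [Finset.sum_congr rfl (g := fun _ => (0 : ℝ)) (by intro x hx; simp_all)]
  simp

/-- Sum over the first part of a function that is constant up to corrections at two vertices. -/
theorem sum_first_part {n m : ℕ} (hm : 2 ≤ m) (hn : n = 2 * m) (c d e : ℝ) :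
    (∑ w : Fin n, if (w : ℕ) < m then
      c + (if (w : ℕ) = 0 then d else 0) + (if (w : ℕ) = 1 then e else 0) else 0)
      = m * c + d + e := by
  have h0 : (∑ w : Fin n, if w = ⟨0, by omega⟩ then d else 0) = d := by simp
  have h1 : (∑ w : Fin n, if w = ⟨1, by omega⟩ then e else 0) = e := by simp
  rw [← sum_ite_lt_half hn c, ← h0, ← h1, ← Finset.sum_add_distrib, ← Finset.sum_add_distrib]
  simp only [h0, h1]
  refine Finset.sum_congr rfl fun w _ => ?_
  simp only [Fin.ext_iff]
  split_ifs <;> first | (exfalso; omega) | simp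

/-- Sum over the second part of a function that is constant up to a correction at one vertex. -/
theorem sum_second_part {n m : ℕ} (hm : 2 ≤ m) (hn : n = 2 * m) (c d : ℝ) :
    (∑ w : Fin n, if (w : ℕ) < m then 0 else c - (if (w : ℕ) = m then d else 0))
      = m * c - d := by
  have h0 : (∑ w : Fin n, if w = ⟨m, by omega⟩ then d else 0) = d := by simp
  rw [← sum_ite_ge_half hn c, ← h0, ← Finset.sum_sub_distrib]
  simp only [h0]
  refine Finset.sum_congr rfl fun w _ => ?_
  simp only [Fin.ext_iff]
  split_ifs <;> first | (exfalso; omega) | simp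

/-- Every nonzero eigenvalue is a root of the quotient polynomial. -/
theorem quartic_of_hasEigenvalue {n m : ℕ} (hm : 2 ≤ m) (hn : n = 2 * m) {x : ℝ} (hx : x ≠ 0)
    (h : Module.End.HasEigenvalue
      (Matrix.toLin' ((KbipPlusMinus n m).adjMatrix ℝ)) x) :
    x ^ 4 - (m : ℝ) ^ 2 * x ^ 2 - (2 * m - 2) * x + 1 + 2 * (m : ℝ) ^ 2 - 4 * m = 0 := by
  obtain ⟨v, hv, hv0⟩ := h.exists_hasEigenvector
  rw [Module.End.mem_eigenspace_iff, Matrix.toLin'_apply] at hv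
  by_contra hf
  have key (u : Fin n) := (adjMatrix_KbipPlusMinus_mulVec hm hn v u).symm.trans (congrFun hv u)
  simp only [Pi.smul_apply, smul_eq_mul] at key
  set A := ∑ w : Fin n, if (w : ℕ) < m then v w else 0 with hA
  set B := ∑ w : Fin n, if (w : ℕ) < m then 0 else v w with hB
  set a := v ⟨0, by omega⟩
  set b := v ⟨1, by omega⟩
  set c := v ⟨m, by omega⟩
  have E1 : B + (b - c) = x * a := by
    simpa [show 0 < m by omega] using key ⟨0, by omega⟩
  have E2 : B + a = x * b := by
    simpa [show 1 < m by omega] using key ⟨1, by omega⟩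
  have E3 : A - a = x * c := by
    simpa using key ⟨m, by omega⟩
  have E4 : x * A = m * B + (b - c) + a := by
    rw [← sum_first_part hm hn B (b - c) a, hA, Finset.mul_sum]
    refine Finset.sum_congr rfl fun w _ => ?_
    have := key w
    split_ifs at * <;> simp_all
  have E5 : x * B = m * A - a := by
    rw [← sum_second_part hm hn A a, hB, Finset.mul_sum]
    refine Finset.sum_congr rfl fun w _ => ?_
    have := key w
    split_ifs at * <;> simp_all
  obtain ⟨s, hs⟩ : ∃ s, a = x * s := ⟨a / x, by field_simp⟩
  have hBX : B = x * (b - s) := by linear_combination E2 - hs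
  have hAY : A = x * (c + s) := by linear_combination E3 + hs
  have R1 : x * (b - s) - m * (c + s) + s = 0 :=
    mul_left_cancel₀ hx (by linear_combination E5 - x * hBX + m * hAY - hs)
  have R2 : -(m - 1) * (b - s) + x * (c + s) - (x + 1) * s = 0 :=
    mul_left_cancel₀ hx (by
      linear_combination E4 + E1 + (m - 1) * hBX - x * hAY + (1 + x) * hs)
  have R3 : -(b - s) - (m - 1) * (c + s) + (x ^ 2 - 1) * s = 0 := by
    linear_combination -E1 + hBX - x * hs + R1
  have hs0 : s = 0 := by
    refine (mul_eq_zero.1 ?_).resolve_left hf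
    linear_combination ((m - 1) ^ 2 + x) * R1 + ((m - 1) * x + m) * R2
      + (x ^ 2 - m * (m - 1)) * R3
  have hX : b - s = 0 := by
    refine (mul_eq_zero.1 ?_).resolve_left hf
    linear_combination (x * (x ^ 2 - 1) - (m - 1) * (x + 1)) * R1
      + (m * (x ^ 2 - 1) - (m - 1)) * R2 + (m * x + m - x) * R3
  have hY : c + s = 0 := by
    refine (mul_eq_zero.1 ?_).resolve_left hf
    linear_combination ((m - 1) * (x ^ 2 - 1) + (x + 1)) * R1
      + (x * (x ^ 2 - 1) + 1) * R2 + (x ^ 2 + x - m + 1) * R3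
  have ha0 : a = 0 := by rw [hs, hs0, mul_zero]
  have hb0 : b = 0 := by linarith
  have hc0 : c = 0 := by linarith
  have hA0 : A = 0 := by rw [hAY, hY, mul_zero]
  have hB0 : B = 0 := by rw [hBX, hX, mul_zero]
  refine hv0 (funext fun u => ?_)
  have := key u
  simp only [ha0, hb0, hc0, hA0, hB0, sub_zero, add_zero, ite_self] at this
  exact (mul_eq_zero.1 this.symm).resolve_left hx

/-- Every root of the quotient polynomial beyond `m` is an eigenvalue. -/
theorem hasEigenvalue_of_quartic {n m : ℕ} (hm : 2 ≤ m) (hn : n = 2 * m) {x : ℝ} (hx : (m : ℝ) < x)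
    (h : x ^ 4 - (m : ℝ) ^ 2 * x ^ 2 - (2 * m - 2) * x + 1 + 2 * (m : ℝ) ^ 2 - 4 * m = 0) :
    Module.End.HasEigenvalue (Matrix.toLin' ((KbipPlusMinus n m).adjMatrix ℝ)) x := by
  have hm' : (2 : ℝ) ≤ m := by exact_mod_cast hm
  set X : ℝ := (m - 1) * x + m with hX
  set Y : ℝ := x ^ 2 + x - m + 1 with hY
  set s : ℝ := x ^ 2 - m * (m - 1) with hs
  let v : Fin n → ℝ := fun w => if (w : ℕ) < m then
      X + (if (w : ℕ) = 0 then x * s - X else 0) + (if (w : ℕ) = 1 then s else 0)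
    else Y - (if (w : ℕ) = m then s else 0)
  have hA : (∑ w : Fin n, if (w : ℕ) < m then v w else 0) = m * X + (x * s - X) + s := by
    rw [← sum_first_part hm hn X (x * s - X) s]
    refine Finset.sum_congr rfl fun w _ => ?_
    by_cases hw : (w : ℕ) < m <;> simp [v, hw]
  have hB : (∑ w : Fin n, if (w : ℕ) < m then 0 else v w) = m * Y - s := by
    rw [← sum_second_part hm hn Y s]
    refine Finset.sum_congr rfl fun w _ => ?_
    by_cases hw : (w : ℕ) < m <;> simp [v, hw]
  have h0 : v ⟨0, by omega⟩ = x * s := by simp [v, show 0 < m by omega]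
  have h1 : v ⟨1, by omega⟩ = X + s := by simp [v, show 1 < m by omega]
  have h2 : v ⟨m, by omega⟩ = Y - s := by simp [v]
  refine Module.End.hasEigenvalue_of_hasEigenvector (x := v) ⟨?_, fun hv => ?_⟩
  · rw [Module.End.mem_eigenspace_iff, Matrix.toLin'_apply]
    ext u
    rw [adjMatrix_KbipPlusMinus_mulVec hm hn, hA, hB, h0, h1, h2, Pi.smul_apply, smul_eq_mul]
    simp only [v]
    split_ifs <;> first | (exfalso; omega) | skip
    all_goals simp only [hX, hY, hs]
    all_goals first | ring1 | linear_combination h | linear_combination -h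
  · have hpos : 0 < X + s := by
      rw [hX, hs]; nlinarith
    rw [hv] at h1
    exact hpos.ne h1

theorem triangleCount_KbipPlusMinus {n m : ℕ} (hm : 2 ≤ m) (hn : n = 2 * m) :
    triangleCount (KbipPlusMinus n m) = m - 1 := by
  classical
  let f : Fin n → Finset (Fin n) := fun w => {⟨0, by omega⟩, ⟨1, by omega⟩, w}
  have hf : Set.InjOn f (Finset.Ioi (⟨m, by omega⟩ : Fin n)) := by
    intro w hw w' hw' hww
    have : w ∈ f w' := by rw [← hww]; simp [f]
    simp only [f, Finset.mem_insert, Finset.mem_singleton, Fin.ext_iff, Finset.coe_Ioi,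
      Set.mem_Ioi, Fin.lt_def] at this hw ⊢
    omega
  have hcard : ((Finset.Ioi (⟨m, by omega⟩ : Fin n)).image f).card = m - 1 := by
    rw [Finset.card_image_of_injOn hf, Fin.card_Ioi]
    simp only
    omega
  rw [triangleCount, ← hcard]
  congr 1
  ext t
  simp only [SimpleGraph.mem_cliqueFinset_iff, SimpleGraph.is3Clique_iff, Finset.mem_image,
    Finset.mem_Ioi, Fin.lt_def, KbipPlusMinus_adj hm]
  constructor
  · rintro ⟨a, b, c, hab, hac, hbc, rfl⟩
    have : ∃ w ∈ ({a, b, c} : Finset (Fin n)), m < (w : ℕ) := by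
      simp only [Finset.mem_insert, Finset.mem_singleton, exists_eq_or_imp, exists_eq_left]
      omega
    obtain ⟨w, hw, hmw⟩ := this
    refine ⟨w, hmw, ?_⟩
    ext z
    simp only [f, Finset.mem_insert, Finset.mem_singleton, Fin.ext_iff] at hw ⊢
    omega
  · rintro ⟨w, hw, rfl⟩
    refine ⟨⟨0, by omega⟩, ⟨1, by omega⟩, w, by simp, ?_, ?_, rfl⟩ <;> simp only <;> omega

/-- The quotient polynomial has a root beyond `m`. -/
theorem exists_quartic_root_gt {m : ℕ} (hm : 2 ≤ m) : ∃ x : ℝ, (m : ℝ) < x ∧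
    x ^ 4 - (m : ℝ) ^ 2 * x ^ 2 - (2 * m - 2) * x + 1 + 2 * (m : ℝ) ^ 2 - 4 * m = 0 := by
  have hm' : (2 : ℝ) ≤ m := by exact_mod_cast hm
  let p : ℝ → ℝ := fun x =>
    x ^ 4 - (m : ℝ) ^ 2 * x ^ 2 - (2 * m - 2) * x + 1 + 2 * (m : ℝ) ^ 2 - 4 * m
  have hlo : p m < 0 := by
    have : p m = 1 - 2 * m := by simp only [p]; ring
    linarith
  have hhi : 0 ≤ p (m + 1) := by
    have : p (m + 1) = 2 * (m : ℝ) ^ 3 + 5 * m ^ 2 + 4 := by simp only [p]; ring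
    rw [this]
    positivity
  obtain ⟨x, hx, hpx⟩ := intermediate_value_Icc (show (m : ℝ) ≤ m + 1 by linarith)
    (f := p) (by fun_prop) ⟨hlo.le, hhi⟩
  refine ⟨x, lt_of_le_of_ne hx.1 ?_, hpx⟩
  rintro rfl
  exact hlo.ne hpx

/-- For even `n ≥ 4`, `λ(K^{+|}_{n/2,n/2})` is the largest real root of
`f₂(x) = x⁴ − (n²/4)x² − (n−2)x + 1 + n²/2 − 2n`; moreover `λ(K^{+|}_{n/2,n/2}) > n/2`
and `K^{+|}_{n/2,n/2}` has exactly `n/2 − 1` triangles. -/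
theorem specRad_KbipPlusMinus_even (n : ℕ) (hn : 4 ≤ n) (he : Even n) :
    ((specRad (KbipPlusMinus n (n / 2))) ^ 4
        - ((n : ℝ) ^ 2 / 4) * (specRad (KbipPlusMinus n (n / 2))) ^ 2
        - ((n : ℝ) - 2) * specRad (KbipPlusMinus n (n / 2))
        + 1 + (n : ℝ) ^ 2 / 2 - 2 * (n : ℝ) = 0 ∧
      ∀ x : ℝ, x ^ 4 - ((n : ℝ) ^ 2 / 4) * x ^ 2 - ((n : ℝ) - 2) * x
          + 1 + (n : ℝ) ^ 2 / 2 - 2 * (n : ℝ) = 0 →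
        x ≤ specRad (KbipPlusMinus n (n / 2))) ∧
      (n : ℝ) / 2 < specRad (KbipPlusMinus n (n / 2)) ∧
      triangleCount (KbipPlusMinus n (n / 2)) = n / 2 - 1 := by
  obtain ⟨m, hnm⟩ := he.two_dvd
  have hm : 2 ≤ m := by omega
  have hdiv : n / 2 = m := by omega
  have hcast : (n : ℝ) = 2 * m := by exact_mod_cast hnm
  have hpoly (x : ℝ) : x ^ 4 - ((n : ℝ) ^ 2 / 4) * x ^ 2 - ((n : ℝ) - 2) * x
      + 1 + (n : ℝ) ^ 2 / 2 - 2 * (n : ℝ) =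
      x ^ 4 - (m : ℝ) ^ 2 * x ^ 2 - (2 * m - 2) * x + 1 + 2 * (m : ℝ) ^ 2 - 4 * m := by
    rw [hcast]; ring
  simp only [hpoly, hdiv]
  set S := {μ : ℝ | Module.End.HasEigenvalue
    (Matrix.toLin' ((KbipPlusMinus n m).adjMatrix ℝ)) μ} with hS
  have hspec : specRad (KbipPlusMinus n m) = sSup S := by
    rw [hS, specRad]
    congr!
  have hfin : S.Finite := Module.End.finite_hasEigenvalue _
  obtain ⟨r, hr, hr0⟩ := exists_quartic_root_gt hm
  have hrS : r ∈ S := hasEigenvalue_of_quartic hm hnm hr hr0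
  have hlt : (m : ℝ) < sSup S := hr.trans_le (le_csSup hfin.bddAbove hrS)
  have hmem : sSup S ∈ S := Set.Nonempty.csSup_mem ⟨r, hrS⟩ hfin
  have hne : sSup S ≠ 0 := (m.cast_nonneg.trans_lt hlt).ne'
  rw [hspec]
  refine ⟨⟨quartic_of_hasEigenvalue hm hnm hne hmem, fun x hx => ?_⟩, ?_,
    triangleCount_KbipPlusMinus hm hnm⟩
  · rcases le_or_gt x m with hxm | hxm
    · exact hxm.trans hlt.le
    · exact le_csSup hfin.bddAbove (hasEigenvalue_of_quartic hm hnm hxm hx)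
  · rw [hcast]
    linarith
end

section
/- Let n ≥ 5 be an odd integer, and let K^{+|}_{(n+1)/2,(n−1)/2} be the graph on n vertices obtained from the complete bipartite graph K_{(n+1)/2,(n−1)/2} by adding an edge e₁ inside the part of size (n+1)/2 and deleting an edge e₂ between the two parts such that e₂ shares an endpoint with e₁. Then λ(K^{+|}_{(n+1)/2,(n−1)/2}) is the largest real root of the polynomial f₃(x) = x⁴ − ((n²−1)/4)x² − (n−3)x + n²/2 − 2n + 3/2; moreover λ(K^{+|}_{(n+1)/2,(n−1)/2}) > √(n²−1)/2 and the number of triangles in K^{+|}_{(n+1)/2,(n−1)/2} is exactly (n−1)/2 − 1. -/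
open Matrix

section KbipPlusMinus

variable {k : ℕ}

def pivot (k : ℕ) : Fin (2 * k + 3) := ⟨k + 2, by omega⟩

lemma KbipPlusMinus_adj_iff (u v : Fin (2 * k + 3)) :
    (KbipPlusMinus (2 * k + 3) (k + 2)).Adj u v ↔
      ((u : ℕ) < k + 2 ∧ k + 2 ≤ (v : ℕ)) ∧ ¬((u : ℕ) = 0 ∧ (v : ℕ) = k + 2) ∨
      ((v : ℕ) < k + 2 ∧ k + 2 ≤ (u : ℕ)) ∧ ¬((v : ℕ) = 0 ∧ (u : ℕ) = k + 2) ∨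
      (u : ℕ) = 0 ∧ (v : ℕ) = 1 ∨ (v : ℕ) = 0 ∧ (u : ℕ) = 1 := by
  simp only [KbipPlusMinus, SimpleGraph.fromRel_adj, ne_eq, Fin.ext_iff]
  omega

/-- The sum of `v` over the part of size `k + 2`. -/
def leftSum (v : Fin (2 * k + 3) → ℝ) : ℝ :=
  ∑ i : Fin (2 * k + 3), if (i : ℕ) < k + 2 then v i else 0

/-- The sum of `v` over the part of size `k + 1`. -/
def rightSum (v : Fin (2 * k + 3) → ℝ) : ℝ :=
  ∑ i : Fin (2 * k + 3), if k + 2 ≤ (i : ℕ) then v i else 0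

lemma card_left :
    (Finset.univ.filter fun i : Fin (2 * k + 3) => (i : ℕ) < k + 2).card = k + 2 := by
  rw [Fin.card_filter_val_lt]; omega

lemma card_right :
    (Finset.univ.filter fun i : Fin (2 * k + 3) => k + 2 ≤ (i : ℕ)).card = k + 1 := by
  have h := Finset.card_filter_add_card_filter_not (s := Finset.univ)
    (fun i : Fin (2 * k + 3) => (i : ℕ) < k + 2)
  simp only [card_left, not_lt, Finset.card_univ, Fintype.card_fin] at h
  omega

lemma leftSum_eq {v : Fin (2 * k + 3) → ℝ} {y : ℝ}
    (h : ∀ i : Fin (2 * k + 3), 2 ≤ (i : ℕ) → (i : ℕ) < k + 2 → v i = y) :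
    leftSum v = v 0 + v 1 + k * y := by
  have key : ∀ i : Fin (2 * k + 3), (if (i : ℕ) < k + 2 then v i else 0) =
      (if (i : ℕ) < k + 2 then y else 0) + (if i = 0 then v 0 - y else 0) +
        (if i = 1 then v 1 - y else 0) := by
    intro i
    by_cases h0 : i = 0
    · subst h0; simp
    by_cases h1 : i = 1
    · subst h1; simp
    have h0' : (i : ℕ) ≠ 0 := fun h => h0 (Fin.ext h)
    have h1' : (i : ℕ) ≠ 1 := fun h => h1 (Fin.ext h)
    by_cases hi : (i : ℕ) < k + 2
    · simp [h0, h1, hi, h i (by omega) hi]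
    · simp [h0, h1, hi]
  rw [leftSum, Finset.sum_congr rfl fun i _ => key i]
  simp only [Finset.sum_add_distrib, Finset.sum_ite_eq', Finset.mem_univ, if_true,
    ← Finset.sum_filter, Finset.sum_const, card_left]
  simp
  ring

lemma rightSum_eq {v : Fin (2 * k + 3) → ℝ} {w : ℝ}
    (h : ∀ i : Fin (2 * k + 3), k + 2 < (i : ℕ) → v i = w) :
    rightSum v = v (pivot k) + k * w := by
  have key : ∀ i : Fin (2 * k + 3), (if k + 2 ≤ (i : ℕ) then v i else 0) =
      (if k + 2 ≤ (i : ℕ) then w else 0) + (if i = pivot k then v (pivot k) - w else 0) := by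
    intro i
    by_cases h0 : i = pivot k
    · subst h0; simp [pivot]
    have h0' : (i : ℕ) ≠ k + 2 := fun h => h0 (Fin.ext h)
    by_cases hi : k + 2 ≤ (i : ℕ)
    · simp [h0, hi, h i (by omega)]
    · simp [h0, hi]
  rw [rightSum, Finset.sum_congr rfl fun i _ => key i]
  simp only [Finset.sum_add_distrib, Finset.sum_ite_eq', Finset.mem_univ, if_true,
    ← Finset.sum_filter, Finset.sum_const, card_right]
  simp
  ring

open Classical in
lemma adjMatrix_mulVec_KbipPlusMinus (v : Fin (2 * k + 3) → ℝ) (u : Fin (2 * k + 3)) :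
    ((KbipPlusMinus (2 * k + 3) (k + 2)).adjMatrix ℝ *ᵥ v) u =
      if (u : ℕ) = 0 then v 1 + rightSum v - v (pivot k)
      else if (u : ℕ) = 1 then v 0 + rightSum v
      else if (u : ℕ) < k + 2 then rightSum v
      else if (u : ℕ) = k + 2 then leftSum v - v 0
      else leftSum v := by
  have e0 (j : Fin (2 * k + 3)) : j = 0 ↔ (j : ℕ) = 0 := by simp
  have e1 (j : Fin (2 * k + 3)) : j = 1 ↔ (j : ℕ) = 1 := by simp [Fin.ext_iff]
  have ep (j : Fin (2 * k + 3)) : j = pivot k ↔ (j : ℕ) = k + 2 := by simp [Fin.ext_iff, pivot]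
  have s0 : v 0 = ∑ j : Fin (2 * k + 3), if (j : ℕ) = 0 then v j else 0 := by simp [← e0]
  have s1 : v 1 = ∑ j : Fin (2 * k + 3), if (j : ℕ) = 1 then v j else 0 := by simp [← e1]
  have sp : v (pivot k) = ∑ j : Fin (2 * k + 3), if (j : ℕ) = k + 2 then v j else 0 := by simp [← ep]
  simp only [Matrix.mulVec, dotProduct, SimpleGraph.adjMatrix_apply, ite_mul, one_mul, zero_mul,
    KbipPlusMinus_adj_iff, leftSum, rightSum]
  split_ifs with h0 h1 h2 h3
  · rw [s1, sp, ← Finset.sum_add_distrib, ← Finset.sum_sub_distrib]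
    refine Finset.sum_congr rfl fun j _ => ?_
    grind
  · rw [s0, ← Finset.sum_add_distrib]
    refine Finset.sum_congr rfl fun j _ => ?_
    grind
  · refine Finset.sum_congr rfl fun j _ => ?_
    grind
  · rw [s0, ← Finset.sum_sub_distrib]
    refine Finset.sum_congr rfl fun j _ => ?_
    grind
  · refine Finset.sum_congr rfl fun j _ => ?_
    grind

/-- The quartic factor of the characteristic polynomial of the quotient matrix. -/
def quartic (k : ℕ) (x : ℝ) : ℝ :=
  x ^ 4 - (k + 1) * (k + 2) * x ^ 2 - 2 * k * x + 2 * k * (k + 1)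

open Classical in
lemma quartic_eq_zero_of_hasEigenvalue {μ : ℝ} (hμ : μ ≠ 0)
    (h : Module.End.HasEigenvalue
      (Matrix.toLin' ((KbipPlusMinus (2 * k + 3) (k + 2)).adjMatrix ℝ)) μ) :
    quartic k μ = 0 := by
  obtain ⟨v, hv⟩ := h.exists_hasEigenvector
  have hv0 := hv.2
  have hmul := hv.apply_eq_smul
  rw [Matrix.toLin'_apply] at hmul
  have heq : ∀ u, μ * v u = _ := fun u =>
    (congrFun hmul u).symm.trans (adjMatrix_mulVec_KbipPlusMinus v u)
  have hx0 : μ * v 0 = v 1 + rightSum v - v (pivot k) := by simpa using heq 0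
  have hx1 : μ * v 1 = v 0 + rightSum v := by simpa using heq 1
  have hz : μ * v (pivot k) = leftSum v - v 0 := by simpa [pivot] using heq (pivot k)
  have hy : ∀ i : Fin (2 * k + 3), 2 ≤ (i : ℕ) → (i : ℕ) < k + 2 → v i = rightSum v / μ := by
    intro i h2 hi
    rw [eq_div_iff hμ, mul_comm, heq i, if_neg (by omega), if_neg (by omega), if_pos hi]
  have hw : ∀ i : Fin (2 * k + 3), k + 2 < (i : ℕ) → v i = leftSum v / μ := by
    intro i hi
    rw [eq_div_iff hμ, mul_comm, heq i, if_neg (by omega), if_neg (by omega),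
      if_neg (by omega), if_neg (by omega)]
  have hL := leftSum_eq hy
  have hR := rightSum_eq hw
  obtain ⟨w, hwdef⟩ : ∃ w, w = leftSum v / μ := ⟨_, rfl⟩
  obtain ⟨y, hydef⟩ : ∃ y, y = rightSum v / μ := ⟨_, rfl⟩
  have hLw : leftSum v = μ * w := by rw [hwdef]; field_simp
  have hRy : rightSum v = μ * y := by rw [hydef]; field_simp
  rw [← hydef, hLw] at hL
  rw [← hwdef, hRy] at hR
  rw [hRy] at hx0 hx1
  rw [hLw] at hz
  by_contra hq
  have hx0' : v 0 = μ * (w - v (pivot k)) := by linear_combination hz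
  have hx1' : v 1 = w - v (pivot k) + y := by
    apply mul_left_cancel₀ hμ
    linear_combination hx1 + hx0'
  have e1 : w * (μ ^ 3 - μ - k - k * μ) = v (pivot k) * (μ ^ 3 - μ + 1) := by
    rw [hx0', hx1'] at hx0
    linear_combination μ * hx0 + (1 + μ) * hR
  have e2 : w * (μ + (k + 1) * k) = v (pivot k) * (μ ^ 2 + μ - k - 1) := by
    rw [hx0', hx1'] at hL
    linear_combination -μ * hL - (k + 1) * hR
  have hwz : w = 0 ∧ v (pivot k) = 0 := by
    have hne : μ * quartic k μ ≠ 0 := mul_ne_zero hμ hq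
    constructor
    · apply (mul_eq_zero.mp _).resolve_left hne
      rw [quartic]
      linear_combination (μ ^ 2 + μ - k - 1) * e1 - (μ ^ 3 - μ + 1) * e2
    · apply (mul_eq_zero.mp _).resolve_left hne
      rw [quartic]
      linear_combination (μ + (k + 1) * k) * e1 - (μ ^ 3 - μ - k - k * μ) * e2
  obtain ⟨hw0, hz0⟩ := hwz
  have hy0 : y = 0 := by
    apply (mul_eq_zero.mp _).resolve_left hμ
    rw [hR, hw0, hz0]; ring
  rw [hw0, hz0] at hx0' hx1'
  rw [hy0] at hx1'
  apply hv0
  funext i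
  rw [Pi.zero_apply]
  by_cases i0 : (i : ℕ) = 0
  · rw [show i = 0 from Fin.ext i0, hx0']; ring
  by_cases i1 : (i : ℕ) = 1
  · rw [show i = 1 from Fin.ext i1, hx1']; ring
  by_cases hi : (i : ℕ) < k + 2
  · rw [hy i (by omega) hi, ← hydef, hy0]
  by_cases hip : (i : ℕ) = k + 2
  · rw [show i = pivot k from Fin.ext hip, hz0]
  · rw [hw i (by omega), ← hwdef, hw0]

open Classical in
lemma hasEigenvalue_of_quartic_eq_zero {μ : ℝ} (hμ : 0 < μ) (hq : quartic k μ = 0) :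
    Module.End.HasEigenvalue
      (Matrix.toLin' ((KbipPlusMinus (2 * k + 3) (k + 2)).adjMatrix ℝ)) μ := by
  obtain ⟨v, hv⟩ : ∃ v : Fin (2 * k + 3) → ℝ, ∀ i, v i =
      if (i : ℕ) = 0 then μ * (1 + k + k * μ)
      else if (i : ℕ) = 1 then 1 + k + k * μ + ((k + 1) * μ ^ 2 - (2 * k + 1))
      else if (i : ℕ) < k + 2 then (k + 1) * μ ^ 2 - (2 * k + 1)
      else if (i : ℕ) = k + 2 then μ ^ 3 - μ - k - k * μ
      else μ ^ 3 - μ + 1 := ⟨_, fun _ => rfl⟩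
  have hx0 : v 0 = μ * (1 + k + k * μ) := by simp [hv]
  have hx1 : v 1 = 1 + k + k * μ + ((k + 1) * μ ^ 2 - (2 * k + 1)) := by simp [hv]
  have hz : v (pivot k) = μ ^ 3 - μ - k - k * μ := by simp [hv, pivot]
  have hL : leftSum v = v 0 + v 1 + k * ((k + 1) * μ ^ 2 - (2 * k + 1)) :=
    leftSum_eq fun i h2 hi => by
      rw [hv, if_neg (by omega), if_neg (by omega), if_pos hi]
  have hR : rightSum v = v (pivot k) + k * (μ ^ 3 - μ + 1) :=
    rightSum_eq fun i hi => by
      rw [hv, if_neg (by omega), if_neg (by omega), if_neg (by omega), if_neg (by omega)]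
  rw [quartic] at hq
  refine Module.End.hasEigenvalue_of_hasEigenvector (x := v)
    ⟨Module.End.mem_eigenspace_iff.mpr ?_, fun h => ?_⟩
  · rw [Matrix.toLin'_apply]
    funext i
    rw [adjMatrix_mulVec_KbipPlusMinus, Pi.smul_apply, smul_eq_mul, hv i, hL, hR, hx0, hx1, hz]
    split_ifs
    · ring
    · ring
    · ring
    · linear_combination -hq
    · linear_combination -hq
  · have h0 : v 0 = 0 := by rw [h]; rfl
    rw [hx0] at h0
    have : 0 < μ * (1 + k + k * μ) := by positivity
    linarith

/-- The quartic is negative at `√((k + 1) (k + 2))`, so it has a root beyond that point. -/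
lemma exists_quartic_root (hk : 1 ≤ k) :
    ∃ x : ℝ, √((k + 1) * (k + 2)) < x ∧ quartic k x = 0 := by
  have hk' : (1 : ℝ) ≤ k := by exact_mod_cast hk
  set s : ℝ := √((k + 1) * (k + 2)) with hs
  have hs2 : s ^ 2 = (k + 1) * (k + 2) := Real.sq_sqrt (by positivity)
  have hsk : (k : ℝ) + 1 < s := Real.lt_sqrt_of_sq_lt (by nlinarith)
  have hneg : quartic k s < 0 := by
    have : quartic k s = 2 * k * (k + 1 - s) := by
      rw [quartic]; linear_combination s ^ 2 * hs2
    rw [this]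
    exact mul_neg_of_pos_of_neg (by linarith) (by linarith)
  have hpos : 0 < quartic k (2 * s) := by
    have : quartic k (2 * s) = 12 * s ^ 4 - 4 * k * s + 2 * k * (k + 1) := by
      rw [quartic]; linear_combination 4 * s ^ 2 * hs2
    rw [this]
    have h1 : (k : ℝ) * s ≤ s ^ 2 := by nlinarith
    have h2 : s ^ 2 ≤ s ^ 4 := by nlinarith [sq_nonneg (s ^ 2 - 1)]
    nlinarith
  have hcont : ContinuousOn (quartic k) (Set.Icc s (2 * s)) := by
    unfold quartic; fun_prop
  obtain ⟨x, hx, hx0⟩ := intermediate_value_Icc (by linarith) hcont ⟨hneg.le, hpos.le⟩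
  refine ⟨x, lt_of_le_of_ne hx.1 ?_, hx0⟩
  rintro rfl
  exact hneg.ne hx0

lemma specRad_KbipPlusMinus_isGreatest (hk : 1 ≤ k) :
    √((k + 1) * (k + 2)) < specRad (KbipPlusMinus (2 * k + 3) (k + 2)) ∧
      IsGreatest {x : ℝ | quartic k x = 0} (specRad (KbipPlusMinus (2 * k + 3) (k + 2))) := by
  classical
  set T := Matrix.toLin' ((KbipPlusMinus (2 * k + 3) (k + 2)).adjMatrix ℝ) with hT
  have hspec : specRad (KbipPlusMinus (2 * k + 3) (k + 2)) =
      sSup {μ : ℝ | Module.End.HasEigenvalue T μ} := by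
    rw [specRad, hT]
    congr!
  have hfin : {μ : ℝ | Module.End.HasEigenvalue T μ}.Finite := Module.End.finite_hasEigenvalue T
  obtain ⟨r, hr, hr0⟩ := exists_quartic_root hk
  have hrpos : 0 < r := (Real.sqrt_nonneg _).trans_lt hr
  have hrmem : Module.End.HasEigenvalue T r := hasEigenvalue_of_quartic_eq_zero hrpos hr0
  have hrle : r ≤ sSup {μ : ℝ | Module.End.HasEigenvalue T μ} := le_csSup hfin.bddAbove hrmem
  have hmem : Module.End.HasEigenvalue T (sSup {μ : ℝ | Module.End.HasEigenvalue T μ}) :=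
    Set.Nonempty.csSup_mem ⟨r, hrmem⟩ hfin
  rw [hspec]
  refine ⟨hr.trans_le hrle, quartic_eq_zero_of_hasEigenvalue (by linarith) hmem, fun x hx => ?_⟩
  rcases le_or_gt x 0 with h | h
  · linarith
  · exact le_csSup hfin.bddAbove (hasEigenvalue_of_quartic_eq_zero h hx)

lemma KbipPlusMinus_adj_of_same_side {a b : Fin (2 * k + 3)}
    (hab : (KbipPlusMinus (2 * k + 3) (k + 2)).Adj a b)
    (h : (a : ℕ) < k + 2 ↔ (b : ℕ) < k + 2) : a = 0 ∧ b = 1 ∨ a = 1 ∧ b = 0 := by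
  rw [KbipPlusMinus_adj_iff] at hab
  simp only [Fin.ext_iff, Fin.coe_ofNat_eq_mod, Nat.zero_mod,
    Nat.mod_eq_of_lt (show 1 < 2 * k + 3 by omega)]
  omega

lemma KbipPlusMinus_triangle_of_same_side {a b c : Fin (2 * k + 3)}
    (hab : (KbipPlusMinus (2 * k + 3) (k + 2)).Adj a b)
    (hac : (KbipPlusMinus (2 * k + 3) (k + 2)).Adj a c)
    (hbc : (KbipPlusMinus (2 * k + 3) (k + 2)).Adj b c)
    (h : (a : ℕ) < k + 2 ↔ (b : ℕ) < k + 2) :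
    k + 2 < (c : ℕ) ∧ ({0, 1, c} : Finset (Fin (2 * k + 3))) = {a, b, c} := by
  have hc : (KbipPlusMinus (2 * k + 3) (k + 2)).Adj 0 c →
      (KbipPlusMinus (2 * k + 3) (k + 2)).Adj 1 c → k + 2 < (c : ℕ) := by
    simp only [KbipPlusMinus_adj_iff, Fin.coe_ofNat_eq_mod, Nat.zero_mod,
      Nat.mod_eq_of_lt (show 1 < 2 * k + 3 by omega), true_and]
    intro h0 h1
    omega
  obtain ⟨rfl, rfl⟩ | ⟨rfl, rfl⟩ := KbipPlusMinus_adj_of_same_side hab h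
  · exact ⟨hc hac hbc, rfl⟩
  · exact ⟨hc hbc hac, Finset.insert_comm _ _ _⟩

lemma triangleCount_KbipPlusMinus_s9 :
    triangleCount (KbipPlusMinus (2 * k + 3) (k + 2)) = k := by
  classical
  have himage : (KbipPlusMinus (2 * k + 3) (k + 2)).cliqueFinset 3 =
      (Finset.univ.filter fun j : Fin (2 * k + 3) => k + 2 < (j : ℕ)).image
        fun j => {0, 1, j} := by
    ext s
    simp only [SimpleGraph.mem_cliqueFinset_iff, SimpleGraph.is3Clique_iff, Finset.mem_image,
      Finset.mem_filter, Finset.mem_univ, true_and]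
    constructor
    · rintro ⟨a, b, c, hab, hac, hbc, rfl⟩
      by_cases h1 : (a : ℕ) < k + 2 ↔ (b : ℕ) < k + 2
      · exact ⟨c, KbipPlusMinus_triangle_of_same_side hab hac hbc h1⟩
      by_cases h2 : (a : ℕ) < k + 2 ↔ (c : ℕ) < k + 2
      · rw [Finset.pair_comm b c]
        exact ⟨b, KbipPlusMinus_triangle_of_same_side hac hab hbc.symm h2⟩
      · rw [Finset.insert_comm a b, Finset.pair_comm a c]
        exact ⟨a, KbipPlusMinus_triangle_of_same_side hbc hab.symm hac.symm (by tauto)⟩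
    · rintro ⟨j, hj, rfl⟩
      refine ⟨0, 1, j, ?_, ?_, ?_, rfl⟩ <;> rw [KbipPlusMinus_adj_iff]
      · simp
      · simp; omega
      · simp; omega
  have hinj : Set.InjOn (fun j : Fin (2 * k + 3) => ({0, 1, j} : Finset (Fin (2 * k + 3))))
      (Finset.univ.filter fun j : Fin (2 * k + 3) => k + 2 < (j : ℕ)) := by
    intro i hi j hj hij
    have hi' : k + 2 < (i : ℕ) := by simpa using hi
    have : i ∈ ({0, 1, j} : Finset (Fin (2 * k + 3))) := by
      rw [← show ({0, 1, i} : Finset _) = {0, 1, j} from hij]; simp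
    simp only [Finset.mem_insert, Finset.mem_singleton, Fin.ext_iff] at this
    simp at this
    rcases this with h | h | h
    · simp [h] at hi'
    · omega
    · exact Fin.ext h
  have hcard : (Finset.univ.filter fun j : Fin (2 * k + 3) => k + 2 < (j : ℕ)).card = k := by
    have h := Finset.card_filter_add_card_filter_not (s := Finset.univ)
      (fun i : Fin (2 * k + 3) => (i : ℕ) < k + 3)
    simp only [Fin.card_filter_val_lt, not_lt, Finset.card_univ, Fintype.card_fin] at h
    simp only [← Nat.succ_le_iff]
    simp only [Nat.succ_eq_add_one, add_assoc]
    norm_num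
    omega
  have hcount : triangleCount (KbipPlusMinus (2 * k + 3) (k + 2)) =
      ((KbipPlusMinus (2 * k + 3) (k + 2)).cliqueFinset 3).card := by
    rw [triangleCount]; congr!
  rw [hcount, himage, Finset.card_image_of_injOn hinj, hcard]

end KbipPlusMinus

/-- For odd `n ≥ 5`, `λ(K^{+|}_{(n+1)/2,(n−1)/2})` is the largest real root of
`f₃(x) = x⁴ − ((n²−1)/4)x² − (n−3)x + n²/2 − 2n + 3/2`; moreover
`λ(K^{+|}_{(n+1)/2,(n−1)/2}) > √(n²−1)/2` and `K^{+|}_{(n+1)/2,(n−1)/2}` has exactly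
`(n−1)/2 − 1` triangles. -/
theorem specRad_KbipPlusMinus_odd (n : ℕ) (hn : 5 ≤ n) (ho : Odd n) :
    ((specRad (KbipPlusMinus n ((n + 1) / 2))) ^ 4
        - (((n : ℝ) ^ 2 - 1) / 4) * (specRad (KbipPlusMinus n ((n + 1) / 2))) ^ 2
        - ((n : ℝ) - 3) * specRad (KbipPlusMinus n ((n + 1) / 2))
        + (n : ℝ) ^ 2 / 2 - 2 * (n : ℝ) + 3 / 2 = 0 ∧
      ∀ x : ℝ, x ^ 4 - (((n : ℝ) ^ 2 - 1) / 4) * x ^ 2 - ((n : ℝ) - 3) * x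
          + (n : ℝ) ^ 2 / 2 - 2 * (n : ℝ) + 3 / 2 = 0 →
        x ≤ specRad (KbipPlusMinus n ((n + 1) / 2))) ∧
      Real.sqrt ((n : ℝ) ^ 2 - 1) / 2 < specRad (KbipPlusMinus n ((n + 1) / 2)) ∧
      triangleCount (KbipPlusMinus n ((n + 1) / 2)) = (n - 1) / 2 - 1 := by
  obtain ⟨k, rfl⟩ : ∃ k, n = 2 * k + 3 := ⟨(n - 3) / 2, by obtain ⟨m, rfl⟩ := ho; omega⟩
  rw [show (2 * k + 3 + 1) / 2 = k + 2 by omega]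
  obtain ⟨hlt, hroot, hmax⟩ := specRad_KbipPlusMinus_isGreatest (k := k) (by omega)
  refine ⟨⟨?_, fun x hx => hmax ?_⟩, ?_, ?_⟩
  · rw [Set.mem_ofPred_eq, quartic] at hroot
    push_cast
    linear_combination hroot
  · push_cast at hx
    rw [Set.mem_ofPred_eq, quartic]
    linear_combination hx
  · convert hlt using 1
    rw [show (((2 * k + 3 : ℕ) : ℝ) ^ 2 - 1) = 2 ^ 2 * ((k + 1) * (k + 2)) by push_cast; ring,
      Real.sqrt_mul (by norm_num), Real.sqrt_sq (by norm_num)]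
    ring
  · rw [triangleCount_KbipPlusMinus_s9]
    omega
end

section
/- Let G be a simple graph on n vertices, let λ = λ(G), and let x be a nonzero nonnegative eigenvector of the adjacency matrix of G for the eigenvalue λ. Let u* be a vertex at which x attains its maximum coordinate. If the neighborhood N(u*) is an independent set in G, then λ² ≤ ⌊n²/4⌋. -/
open Matrix

/-- If `v` lies in an independent neighborhood of `u`, the neighborhoods of `u` and `v`
are disjoint, so their sizes sum to at most the number of vertices. -/
theorem SimpleGraph.degree_add_degree_le_of_indep_nbhd {V : Type*} [Fintype V]
    (G : SimpleGraph V) [DecidableRel G.Adj] {u v : V}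
    (hind : ∀ a ∈ G.neighborSet u, ∀ b ∈ G.neighborSet u, ¬ G.Adj a b)
    (huv : G.Adj u v) : G.degree u + G.degree v ≤ Fintype.card V := by
  classical
  have hdisj : Disjoint (G.neighborFinset u) (G.neighborFinset v) := by
    refine Finset.disjoint_left.2 fun w hu hv => ?_
    rw [SimpleGraph.mem_neighborFinset] at hu hv
    exact hind v huv w hu hv
  rw [← SimpleGraph.card_neighborFinset_eq_degree, ← SimpleGraph.card_neighborFinset_eq_degree,
    ← Finset.card_union_of_disjoint hdisj]
  exact Finset.card_le_univ _

/-- An eigenvalue of the adjacency matrix whose eigenvector has a positive maximal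
coordinate at `u` is bounded through the degrees of the neighbors of `u`. -/
theorem SimpleGraph.sq_le_sum_degree_of_adjMatrix_mulVec_eq {V : Type*} [Fintype V]
    (G : SimpleGraph V) [DecidableRel G.Adj] {x : V → ℝ} {μ : ℝ}
    (heig : G.adjMatrix ℝ *ᵥ x = μ • x) {u : V} (hpos : 0 < x u) (hmax : ∀ v, x v ≤ x u) :
    μ ^ 2 ≤ ((∑ v ∈ G.neighborFinset u, G.degree v : ℕ) : ℝ) := by
  have hsum (v : V) : ∑ w ∈ G.neighborFinset v, x w = μ * x v := by
    rw [← SimpleGraph.adjMatrix_mulVec_apply, heig, Pi.smul_apply, smul_eq_mul]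
  refine le_of_mul_le_mul_right ?_ hpos
  calc μ ^ 2 * x u = ∑ v ∈ G.neighborFinset u, ∑ w ∈ G.neighborFinset v, x w := by
        simp_rw [hsum, ← Finset.mul_sum, hsum]
        ring
    _ ≤ ∑ v ∈ G.neighborFinset u, (G.degree v : ℝ) * x u := by
        refine Finset.sum_le_sum fun v _ => ?_
        rw [← SimpleGraph.card_neighborFinset_eq_degree, ← nsmul_eq_mul]
        exact Finset.sum_le_card_nsmul _ _ _ fun w _ => hmax w
    _ = _ := by rw [← Finset.sum_mul, Nat.cast_sum]

/-- If `x` is a nonzero nonnegative eigenvector of the adjacency matrix of `G` for the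
eigenvalue `λ = λ(G)`, `u*` is a vertex where `x` attains its maximum coordinate, and
the neighborhood `N(u*)` is an independent set, then `λ² ≤ ⌊n²/4⌋`. -/
theorem specRad_sq_le_of_indep_nbhd (n : ℕ) (G : SimpleGraph (Fin n))
    [DecidableRel G.Adj] (x : Fin n → ℝ) (hx0 : x ≠ 0) (hxnn : ∀ v, 0 ≤ x v)
    (heig : SimpleGraph.adjMatrix ℝ G *ᵥ x = specRad G • x)
    (ustar : Fin n) (hmax : ∀ v, x v ≤ x ustar)
    (hind : ∀ a ∈ G.neighborSet ustar, ∀ b ∈ G.neighborSet ustar, ¬ G.Adj a b) :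
    (specRad G) ^ 2 ≤ ((n ^ 2 / 4 : ℕ) : ℝ) := by
  have hpos : 0 < x ustar := by
    obtain ⟨v, hv⟩ := Function.ne_iff.1 hx0
    exact ((hxnn v).lt_of_ne' hv).trans_le (hmax v)
  refine (G.sq_le_sum_degree_of_adjMatrix_mulVec_eq heig hpos hmax).trans (Nat.cast_le.2 ?_)
  have hdeg : ∀ v ∈ G.neighborFinset ustar, G.degree v ≤ n - G.degree ustar := fun v hv => by
    have h := G.degree_add_degree_le_of_indep_nbhd hind ((G.mem_neighborFinset _ _).1 hv)
    rw [Fintype.card_fin] at h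
    omega
  have hle : G.degree ustar ≤ n := by
    simpa using G.degree_lt_card_verts ustar |>.le
  calc ∑ v ∈ G.neighborFinset ustar, G.degree v
      ≤ G.degree ustar * (n - G.degree ustar) := by
        simpa using Finset.sum_le_card_nsmul _ _ _ hdeg
    _ ≤ n ^ 2 / 4 := by
        rw [Nat.le_div_iff_mul_le (by norm_num)]
        zify [hle]
        nlinarith [sq_nonneg ((n : ℤ) - 2 * G.degree ustar)]
end

section
/- In the Setup, the neighborhood A = N(u*) satisfies |A| ≥ ⌈n/2⌉; moreover if n is even then |A| ≥ n/2 + 1. Consequently |B| ≤ ⌊n/2⌋ − 1. -/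
open Matrix

/-- If every vertex has degree at least `k`, and some vertex has larger degree, then the
spectral radius exceeds `k`. -/
theorem lt_specRad_of_le_degree {V : Type*} [Fintype V] [DecidableEq V] (G : SimpleGraph V)
    [DecidableRel G.Adj] (k : ℕ) (hdeg : ∀ v, k ≤ G.degree v) (w : V) (hw : k < G.degree w) :
    (k : ℝ) < specRad G := by
  by_contra! hle
  have hsup : specRad G =
      sSup {μ : ℝ | Module.End.HasEigenvalue (Matrix.toLin' (G.adjMatrix ℝ)) μ} := by
    unfold specRad
    congr!
  have hbdd : BddAbove {μ : ℝ | Module.End.HasEigenvalue (Matrix.toLin' (G.adjMatrix ℝ)) μ} :=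
    (Module.End.finite_hasEigenvalue _).bddAbove
  have hherm : ((k : ℝ) • (1 : Matrix V V ℝ) - G.adjMatrix ℝ).IsHermitian := by
    simp [Matrix.IsHermitian, Matrix.conjTranspose_eq_transpose_of_trivial]
  have hpsd : ((k : ℝ) • (1 : Matrix V V ℝ) - G.adjMatrix ℝ).PosSemidef := by
    refine hherm.posSemidef_iff_eigenvalues_nonneg.mpr fun i => ?_
    have hv := hherm.mulVec_eigenvectorBasis i
    have hne : (hherm.eigenvectorBasis i).ofLp ≠ 0 := fun h =>
      hherm.eigenvectorBasis.orthonormal.ne_zero i (WithLp.ofLp_injective 2 h)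
    have heig : Module.End.HasEigenvalue (Matrix.toLin' (G.adjMatrix ℝ))
        ((k : ℝ) - hherm.eigenvalues i) := by
      refine Module.End.hasEigenvalue_of_hasEigenvector (x := (hherm.eigenvectorBasis i).ofLp)
        ⟨Module.End.mem_eigenspace_iff.mpr ?_, hne⟩
      rw [Matrix.sub_mulVec, Matrix.smul_mulVec, Matrix.one_mulVec] at hv
      rw [Matrix.toLin'_apply, sub_smul, ← hv, sub_sub_cancel]
    have := (le_csSup hbdd heig).trans (hsup ▸ hle)
    simpa using this
  have hquad := hpsd.dotProduct_mulVec_nonneg (fun _ => 1)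
  have hrow : ((k : ℝ) • (1 : Matrix V V ℝ) - G.adjMatrix ℝ) *ᵥ (fun _ => 1) =
      fun v => (k : ℝ) - G.degree v := by
    ext v
    rw [Matrix.sub_mulVec, Matrix.smul_mulVec, Matrix.one_mulVec]
    simp [SimpleGraph.adjMatrix_mulVec_apply]
  have hneg : ∑ v, ((k : ℝ) - G.degree v) < 0 :=
    Finset.sum_neg' (fun v _ => sub_nonpos.mpr (by exact_mod_cast hdeg v))
      ⟨w, Finset.mem_univ w, sub_neg.mpr (by exact_mod_cast hw)⟩
  rw [hrow] at hquad
  exact hneg.not_ge (by simpa [dotProduct] using hquad)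

theorem KbipPlus_adj_s11 {n a : ℕ} {u v : Fin n} : (KbipPlus n a).Adj u v ↔ (u : ℕ) ≠ v ∧
    ((((u : ℕ) < a ∧ a ≤ (v : ℕ)) ∨ ((u : ℕ) = 0 ∧ (v : ℕ) = 1)) ∨
      (((v : ℕ) < a ∧ a ≤ (u : ℕ)) ∨ ((v : ℕ) = 0 ∧ (u : ℕ) = 1))) := by
  simp only [KbipPlus, SimpleGraph.fromRel_adj, ne_eq, Fin.ext_iff]

theorem card_filter_le_val {n a : ℕ} (han : a ≤ n) :
    (Finset.univ.filter fun u : Fin n => a ≤ (u : ℕ)).card = n - a := by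
  have h := Finset.card_filter_add_card_filter_not (s := Finset.univ)
    fun u : Fin n => (u : ℕ) < a
  simp only [not_lt, Fin.card_filter_val_lt, Finset.card_univ, Fintype.card_fin] at h
  omega

theorem min_le_degree_KbipPlus {n a : ℕ} [DecidableRel (KbipPlus n a).Adj] (han : a ≤ n)
    (v : Fin n) : min a (n - a) ≤ (KbipPlus n a).degree v := by
  rw [← SimpleGraph.card_neighborFinset_eq_degree]
  by_cases hv : (v : ℕ) < a
  · refine (min_le_right _ _).trans ((card_filter_le_val han).symm.le.trans
      (Finset.card_le_card fun u hu => ?_))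
    rw [Finset.mem_filter] at hu
    rw [SimpleGraph.mem_neighborFinset, KbipPlus_adj_s11]
    omega
  · have hlt : (Finset.univ.filter fun u : Fin n => (u : ℕ) < a).card = a := by
      simp [Fin.card_filter_val_lt, han]
    refine (min_le_left _ _).trans (hlt.symm.le.trans (Finset.card_le_card fun u hu => ?_))
    rw [Finset.mem_filter] at hu
    rw [SimpleGraph.mem_neighborFinset, KbipPlus_adj_s11]
    omega

theorem lt_degree_KbipPlus_zero {n a : ℕ} [DecidableRel (KbipPlus n a).Adj] (ha : 2 ≤ a)
    (han : a ≤ n) : n - a < (KbipPlus n a).degree ⟨0, by omega⟩ := by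
  rw [← SimpleGraph.card_neighborFinset_eq_degree]
  refine (card_filter_le_val han).symm.le.trans_lt
    (Finset.card_lt_card (Finset.ssubset_iff.mpr ⟨⟨1, by omega⟩, ?_, fun u hu => ?_⟩))
  · rw [Finset.mem_filter]
    dsimp only
    omega
  · rw [Finset.mem_insert, Finset.mem_filter, Fin.ext_iff] at hu
    rw [SimpleGraph.mem_neighborFinset, KbipPlus_adj_s11]
    dsimp only at hu ⊢
    omega

theorem half_lt_specRad_Kplus (n : ℕ) (hn : 3 ≤ n) : ((n / 2 : ℕ) : ℝ) < specRad (Kplus n) := by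
  classical
  refine lt_specRad_of_le_degree (KbipPlus n ((n + 1) / 2)) _
    (fun v => le_trans ?_ (min_le_degree_KbipPlus (by omega) v)) ⟨0, by omega⟩
    (lt_of_le_of_lt ?_ (lt_degree_KbipPlus_zero (by omega) (by omega)))
  all_goals omega

/-- An eigenvalue with an entrywise positive eigenvector is at most the degree of any vertex
where the eigenvector is maximal. -/
theorem le_degree_of_adjMatrix_mulVec_eq {V : Type*} [Fintype V] (G : SimpleGraph V)
    [DecidableRel G.Adj] {x : V → ℝ} {μ : ℝ} (heig : G.adjMatrix ℝ *ᵥ x = μ • x) {u : V}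
    (hpos : 0 < x u) (hmax : ∀ v, x v ≤ x u) : μ ≤ G.degree u := by
  have h := congrFun heig u
  rw [SimpleGraph.adjMatrix_mulVec_apply, Pi.smul_apply, smul_eq_mul] at h
  refine le_of_mul_le_mul_right ?_ hpos
  rw [← h, ← nsmul_eq_mul]
  exact Finset.sum_le_card_nsmul _ _ _ fun v _ => hmax v

/-- In the Setup, `|A| ≥ ⌈n/2⌉`; if `n` is even then `|A| ≥ n/2 + 1`; consequently
`|B| ≤ ⌊n/2⌋ − 1`, where `A = N(u*)` and `B = V ∖ (A ∪ {u*})`. -/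
theorem setup_degree_lower_bound
    (n : ℕ) (hn : 3 ≤ n) (G : SimpleGraph (Fin n)) [DecidableRel G.Adj]
    (ht : triangleCount G ≤ n / 2)
    (hspec : specRad (Kplus n) ≤ specRad G)
    (hmaxspec : ∀ H : SimpleGraph (Fin n), triangleCount H ≤ n / 2 → specRad H ≤ specRad G)
    (hconn : G.Connected)
    (x : Fin n → ℝ) (hxpos : ∀ v, 0 < x v) (hxunit : ∑ v, x v ^ 2 = 1)
    (heig : SimpleGraph.adjMatrix ℝ G *ᵥ x = specRad G • x)
    (ustar : Fin n) (hustar : ∀ v, x v ≤ x ustar)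
    :
    (n + 1) / 2 ≤ G.degree ustar ∧
      (Even n → n / 2 + 1 ≤ G.degree ustar) ∧
      (Finset.univ \ insert ustar (G.neighborFinset ustar)).card ≤ n / 2 - 1 := by
  have hdeg : n / 2 < G.degree ustar := by
    exact_mod_cast (half_lt_specRad_Kplus n hn).trans_le
      (hspec.trans (le_degree_of_adjMatrix_mulVec_eq G heig (hxpos ustar) hustar))
  have hcard : (Finset.univ \ insert ustar (G.neighborFinset ustar)).card =
      n - (G.degree ustar + 1) := by
    rw [Finset.card_sdiff_of_subset (Finset.subset_univ _),
      Finset.card_insert_of_notMem (by simp), SimpleGraph.card_neighborFinset_eq_degree]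
    simp
  refine ⟨by omega, fun _ => hdeg, by omega⟩
end
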